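/- Let a > 0, R > 0, set A = a·cosh R and B = a·sinh R, and let Ω = {(x,y) : x²/A² + y²/B² < 1}. Let f be smooth on Ω̄ and satisfy the compatibility conditions ∂^{p₁+p₂}f/∂x^{p₁}∂y^{p₂}(±A, 0) = 0 for all integers p₁, p₂ ≥ 0 with 0 ≤ 2p₁ + p₂ ≤ 2. Define u⁰(x,y) = ∫_y^{C_u(x)} f(x,s) ds, where C_u(x) = B·√(1 - x²/A²). Fix a smooth cutoff δ : [0,R] → [0,1] with δ(η) = 1 for η ∈ [0, R/2] and δ(η) = 0 for η ∈ [3R/4, R]. For ε > 0 define, using the elliptic boundary-fitted coordinates x = a·cosh(R-η)·cos τ, y = a·sinh(R-η)·sin τ (0 ≤ η < R, τ ∈ [0,2π]), the approximate corrector φ̄⁰(x,y) = -u⁰(A·cos τ, B·sin τ)·exp(A·sin(τ)·η/ε)·χ_{[π,2π]}(τ)·δ(η). Then there exists a constant κ > 0, independent of ε, such that for every ε ∈ (0,1] and every classical solution u^ε ∈ C²(Ω) ∩ C(Ω̄) of -εΔu^ε - ∂_y u^ε = f in Ω with u^ε = 0 on ∂Ω, one has ‖u^ε - u⁰ - φ̄⁰‖_{L²(Ω)}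 + √ε·‖u^ε - u⁰ - φ̄⁰‖_{H¹(Ω)} ≤ κ·√ε. -/

import Mathlib

open Real MeasureTheory Set

/-- First partial derivative (in the `x`-direction) of a function on `ℝ × ℝ`. -/
noncomputable def partialX (w : ℝ × ℝ → ℝ) (p : ℝ × ℝ) : ℝ :=
  deriv (fun x => w (x, p.2)) p.1

/-- Second partial derivative (in the `y`-direction) of a function on `ℝ × ℝ`. -/
noncomputable def partialY (w : ℝ × ℝ → ℝ) (p : ℝ × ℝ) : ℝ :=
  deriv (fun y => w (p.1, y)) p.2

/-- `L²` norm of `w` on a set `Ω ⊆ ℝ²`. -/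
noncomputable def L2norm (w : ℝ × ℝ → ℝ) (Ω : Set (ℝ × ℝ)) : ℝ :=
  (∫ p in Ω, (w p) ^ 2) ^ (1 / 2 : ℝ)

/-- `H¹` norm of `w` on a set `Ω ⊆ ℝ²`: `‖w‖²_{H¹} = ∫_Ω (w² + |∇w|²)`. -/
noncomputable def H1norm (w : ℝ × ℝ → ℝ) (Ω : Set (ℝ × ℝ)) : ℝ :=
  (∫ p in Ω, (w p) ^ 2 + (partialX w p) ^ 2 + (partialY w p) ^ 2) ^ (1 / 2 : ℝ)

open scoped Topology

/-- The integral of a directional derivative of a compactly supported `C¹` function vanishes. -/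
lemma integral_fderiv_apply_eq_zero {X : ℝ × ℝ → ℝ} (hX : ContDiff ℝ 1 X)
    (hc : HasCompactSupport X) (v : ℝ × ℝ) :
    Integrable (fun p => fderiv ℝ X p v) ∧ ∫ p, fderiv ℝ X p v = 0 := by
  have hd : Continuous (fun p => fderiv ℝ X p v) :=
    (hX.continuous_fderiv one_ne_zero).clm_apply continuous_const
  have hcd : HasCompactSupport (fun p => fderiv ℝ X p v) := hc.fderiv_apply (𝕜 := ℝ) v
  have hi := hd.integrable_of_hasCompactSupport (μ := (volume : Measure (ℝ × ℝ))) hcd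
  refine ⟨hi, ?_⟩
  have h := integral_mul_fderiv_eq_neg_fderiv_mul_of_integrable
    (μ := (volume : Measure (ℝ × ℝ))) (f := fun _ => (1 : ℝ)) (g := X) (v := v)
    (by simp) (by simpa using hi)
    (by simpa using hX.continuous.integrable_of_hasCompactSupport hc)
    (fun _ _ => differentiableAt_const _) (fun p _ => hX.differentiable one_ne_zero p)
  simpa using h

/-- A simple zero is isolated, so a function of one variable has countably many of them. -/
lemma countable_simple_zeros (g : ℝ → ℝ) :
    {x | g x = 0 ∧ deriv g x ≠ 0}.Countable := by
  refine (countable_setOfPred_isolated_right_within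
    (s := {x | g x = 0 ∧ deriv g x ≠ 0})).mono ?_
  rintro x ⟨hx0, hx1⟩
  refine ⟨⟨hx0, hx1⟩, ?_⟩
  have hd : DifferentiableAt ℝ g x := by
    by_contra h
    exact hx1 (deriv_zero_of_not_differentiableAt h)
  have h1 : ∀ᶠ z in 𝓝[≠] x, g z ≠ 0 := hd.hasDerivAt.eventually_ne hx1
  rw [← Filter.eventually_false_iff_eq_bot]
  filter_upwards [self_mem_nhdsWithin,
    h1.filter_mono (nhdsWithin_mono x fun z hz => ne_of_gt hz.2)] with z hz hz'
  exact hz' hz.1.1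

/-- A measurable planar set all of whose horizontal slices are
countable is null. -/
lemma volume_eq_zero_of_countable_slices {s : Set (ℝ × ℝ)} (hs : MeasurableSet s)
    (h : ∀ y, {x | (x, y) ∈ s}.Countable) : volume s = 0 := by
  rw [Measure.volume_eq_prod, Measure.prod_apply_symm hs]
  simp only [lintegral_eq_zero_iff' (measurable_measure_prodMk_right hs).aemeasurable]
  exact Filter.Eventually.of_forall fun y => (h y).measure_zero _

/-- The gradient of a `C¹` function vanishes almost everywhere on its zero set. -/
lemma ae_fderiv_eq_zero_of_eq_zero {Ω : Set (ℝ × ℝ)} (hΩ : IsOpen Ω) {w : ℝ × ℝ → ℝ}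
    (hw : ContDiffOn ℝ 1 w Ω) :
    ∀ᵐ p ∂(volume.restrict Ω), w p = 0 →
      fderiv ℝ w p (1, 0) = 0 ∧ fderiv ℝ w p (0, 1) = 0 := by
  have hcf : ContinuousOn (fun p => fderiv ℝ w p) Ω :=
    hw.continuousOn_fderiv_of_isOpen hΩ le_rfl
  have hmeas : ∀ v : ℝ × ℝ, MeasurableSet (Ω ∩ {p | w p = 0 ∧ fderiv ℝ w p v ≠ 0}) := by
    intro v
    have h1 : MeasurableSet (Ω ∩ w ⁻¹' {0}) := by
      obtain ⟨t, ht, hte⟩ := continuousOn_iff_isClosed.1 hw.continuousOn {0} isClosed_singleton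
      rw [inter_comm, hte]; exact ht.measurableSet.inter hΩ.measurableSet
    have h2 : MeasurableSet (Ω ∩ (fun p => fderiv ℝ w p v) ⁻¹' {0}ᶜ) :=
      ((hcf.clm_apply continuousOn_const).isOpen_inter_preimage hΩ
        isClosed_singleton.isOpen_compl).measurableSet
    convert h1.inter h2 using 1
    ext p; simp; tauto
  have hd : ∀ p ∈ Ω, HasFDerivAt w (fderiv ℝ w p) p := fun p hp =>
    ((hw.contDiffAt (hΩ.mem_nhds hp)).differentiableAt one_ne_zero).hasFDerivAt
  have hx : volume (Ω ∩ {p | w p = 0 ∧ fderiv ℝ w p (1, 0) ≠ 0}) = 0 := by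
    refine volume_eq_zero_of_countable_slices (hmeas _) fun y => ?_
    refine (countable_simple_zeros (fun x => w (x, y))).mono ?_
    rintro x ⟨hp, h0, h1⟩
    refine ⟨h0, ?_⟩
    have := (hd _ hp).comp_hasDerivAt x ((hasDerivAt_id x).prodMk (hasDerivAt_const x y))
    have h2 := this.deriv
    simp only [Function.comp_def, id] at h2
    rw [h2]; exact h1
  have hy : volume (Ω ∩ {p | w p = 0 ∧ fderiv ℝ w p (0, 1) ≠ 0}) = 0 := by
    have hsw : MeasurePreserving (Prod.swap : ℝ × ℝ → ℝ × ℝ) volume volume :=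
      Measure.measurePreserving_swap
    rw [← hsw.measure_preimage (hmeas _).nullMeasurableSet]
    refine volume_eq_zero_of_countable_slices (hsw.measurable (hmeas _)) fun y => ?_
    refine (countable_simple_zeros (fun x => w (y, x))).mono ?_
    rintro x ⟨hp, h0, h1⟩
    refine ⟨h0, ?_⟩
    have := (hd _ hp).comp_hasDerivAt x ((hasDerivAt_const x y).prodMk (hasDerivAt_id x))
    have h2 := this.deriv
    simp only [Function.comp_def] at h2
    simp only [Prod.swap] at h1
    rw [h2]; exact h1
  rw [ae_restrict_iff' hΩ.measurableSet]
  have hx' := measure_eq_zero_iff_ae_notMem.1 hx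
  have hy' := measure_eq_zero_iff_ae_notMem.1 hy
  filter_upwards [hx', hy'] with p h1 h2 hp h0
  constructor
  · by_contra h; exact h1 ⟨hp, h0, h⟩
  · by_contra h; exact h2 ⟨hp, h0, h⟩

/-- Continuous cutoff vanishing for `|t| ≤ k` and equal to `1` for `|t| ≥ 2 * k`. -/
noncomputable def truncSlope (k t : ℝ) : ℝ := max 0 (min 1 (|t| / k - 1))

/-- `C¹` approximation of the identity vanishing for `|t| ≤ k`. -/
noncomputable def trunc (k t : ℝ) : ℝ := ∫ s in (0 : ℝ)..t, truncSlope k s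

/-- Primitive of `trunc k`. -/
noncomputable def truncPrim (k t : ℝ) : ℝ := ∫ s in (0 : ℝ)..t, trunc k s

lemma continuous_truncSlope (k : ℝ) : Continuous (truncSlope k) := by
  unfold truncSlope; fun_prop

lemma truncSlope_nonneg (k t : ℝ) : 0 ≤ truncSlope k t := le_max_left _ _

lemma truncSlope_le_one (k t : ℝ) : truncSlope k t ≤ 1 := by
  simp [truncSlope]

lemma truncSlope_eq_zero {k t : ℝ} (hk : 0 < k) (ht : |t| ≤ k) : truncSlope k t = 0 := by
  have : |t| / k ≤ 1 := (div_le_one hk).2 ht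
  exact max_eq_left ((min_le_right _ _).trans (by linarith))

lemma truncSlope_eq_one {k t : ℝ} (hk : 0 < k) (ht : 2 * k ≤ |t|) : truncSlope k t = 1 := by
  have : 2 ≤ |t| / k := (le_div_iff₀ hk).2 ht
  rw [truncSlope, min_eq_left (by linarith)]; simp

lemma truncSlope_neg (k t : ℝ) : truncSlope k (-t) = truncSlope k t := by
  simp [truncSlope]

lemma hasDerivAt_trunc (k t : ℝ) : HasDerivAt (trunc k) (truncSlope k t) t :=
  (continuous_truncSlope k).integral_hasStrictDerivAt 0 t |>.hasDerivAt

lemma continuous_trunc (k : ℝ) : Continuous (trunc k) :=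
  continuous_iff_continuousAt.2 fun t => (hasDerivAt_trunc k t).continuousAt

lemma hasDerivAt_truncPrim (k t : ℝ) : HasDerivAt (truncPrim k) (trunc k t) t :=
  (continuous_trunc k).integral_hasStrictDerivAt 0 t |>.hasDerivAt

lemma contDiff_trunc (k : ℝ) : ContDiff ℝ 1 (trunc k) := by
  refine contDiff_one_iff_deriv.2 ⟨fun t => (hasDerivAt_trunc k t).differentiableAt, ?_⟩
  rw [show deriv (trunc k) = truncSlope k from funext fun t => (hasDerivAt_trunc k t).deriv]
  exact continuous_truncSlope k

lemma contDiff_truncPrim (k : ℝ) : ContDiff ℝ 1 (truncPrim k) := by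
  refine contDiff_one_iff_deriv.2 ⟨fun t => (hasDerivAt_truncPrim k t).differentiableAt, ?_⟩
  rw [show deriv (truncPrim k) = trunc k from funext fun t => (hasDerivAt_truncPrim k t).deriv]
  exact continuous_trunc k

lemma abs_le_of_mem_uIcc_zero {s t : ℝ} (hs : s ∈ uIcc 0 t) : |s| ≤ |t| := by
  have := abs_sub_left_of_mem_uIcc hs
  simpa using this

lemma trunc_eq_zero {k t : ℝ} (hk : 0 < k) (ht : |t| ≤ k) : trunc k t = 0 := by
  rw [trunc, intervalIntegral.integral_congr (g := fun _ => (0 : ℝ))]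
  · simp
  · intro s hs
    exact truncSlope_eq_zero hk ((abs_le_of_mem_uIcc_zero hs).trans ht)

lemma truncPrim_eq_zero {k t : ℝ} (hk : 0 < k) (ht : |t| ≤ k) : truncPrim k t = 0 := by
  rw [truncPrim, intervalIntegral.integral_congr (g := fun _ => (0 : ℝ))]
  · simp
  · intro s hs
    exact trunc_eq_zero hk ((abs_le_of_mem_uIcc_zero hs).trans ht)

lemma trunc_neg (k t : ℝ) : trunc k (-t) = -trunc k t := by
  have h := intervalIntegral.integral_comp_neg (a := 0) (b := -t) (truncSlope k)
  simp only [truncSlope_neg, neg_zero, neg_neg] at h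
  rw [trunc, h, intervalIntegral.integral_symm, trunc]

lemma truncPrim_neg (k t : ℝ) : truncPrim k (-t) = truncPrim k t := by
  have h := intervalIntegral.integral_comp_neg (a := 0) (b := -t) (trunc k)
  simp only [trunc_neg, neg_zero, neg_neg, intervalIntegral.integral_neg] at h
  rw [intervalIntegral.integral_symm 0 t] at h
  rw [truncPrim, truncPrim]; linarith

lemma trunc_nonneg {k t : ℝ} (ht : 0 ≤ t) : 0 ≤ trunc k t :=
  intervalIntegral.integral_nonneg ht fun s _ => truncSlope_nonneg k s

lemma trunc_sq_le (k t : ℝ) : trunc k t ^ 2 ≤ 2 * truncPrim k t := by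
  wlog ht : 0 ≤ t generalizing t
  · have := this (-t) (by linarith)
    rwa [trunc_neg, truncPrim_neg, neg_sq] at this
  have hd : ∀ s, HasDerivAt (fun s => 2 * truncPrim k s - trunc k s ^ 2)
      (2 * trunc k s - 2 * trunc k s * truncSlope k s) s := fun s => by
    have := ((hasDerivAt_truncPrim k s).const_mul 2).fun_sub ((hasDerivAt_trunc k s).fun_pow 2)
    simpa using this
  have hm : MonotoneOn (fun s => 2 * truncPrim k s - trunc k s ^ 2) (Ici 0) := by
    refine monotoneOn_of_deriv_nonneg (convex_Ici 0)
      (fun s _ => (hd s).continuousAt.continuousWithinAt)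
      (fun s _ => (hd s).differentiableAt.differentiableWithinAt) fun s hs => ?_
    rw [(hd s).deriv]
    rw [interior_Ici] at hs
    have h1 := trunc_nonneg (k := k) (le_of_lt hs)
    have h2 := truncSlope_le_one k s
    nlinarith
  have := hm (self_mem_Ici) ht ht
  simpa [truncPrim, trunc] using this

lemma abs_sub_two_mul_le_abs_trunc {k t : ℝ} (hk : 0 < k) : |t| - 2 * k ≤ |trunc k t| := by
  wlog ht : 0 ≤ t generalizing t
  · have := this (t := -t) (by linarith)
    rwa [trunc_neg, abs_neg, abs_neg] at this
  rw [abs_of_nonneg ht, abs_of_nonneg (trunc_nonneg ht)]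
  rcases le_total t (2 * k) with h | h
  · linarith [trunc_nonneg (k := k) ht]
  · have hi : ∀ a b, IntervalIntegrable (truncSlope k) volume a b :=
      fun a b => (continuous_truncSlope k).intervalIntegrable a b
    rw [trunc, ← intervalIntegral.integral_add_adjacent_intervals (hi 0 (2 * k)) (hi _ _),
      intervalIntegral.integral_congr (a := 2 * k) (b := t) (g := fun _ => (1 : ℝ))]
    · have := trunc_nonneg (k := k) (t := 2 * k) (by linarith)
      rw [trunc] at this
      simp; linarith
    · intro s hs
      rw [uIcc_of_le h] at hs
      exact truncSlope_eq_one hk (hs.1.trans (le_abs_self s))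

/-- Extension by zero of a `C¹` function vanishing off a compact subset of an open set. -/
lemma contDiff_indicator_of_eq_zero {Ω K : Set (ℝ × ℝ)} (hΩ : IsOpen Ω) (hK : IsCompact K)
    (hKΩ : K ⊆ Ω) {H : ℝ × ℝ → ℝ} (hH : ContDiffOn ℝ 1 H Ω) (h0 : ∀ p ∈ Ω, p ∉ K → H p = 0) :
    ContDiff ℝ 1 (Ω.indicator H) ∧ HasCompactSupport (Ω.indicator H) := by
  have hz : ∀ p, p ∉ K → Ω.indicator H p = 0 := by
    intro p hp
    by_cases h : p ∈ Ω
    · rw [indicator_of_mem h]; exact h0 p h hp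
    · exact indicator_of_notMem h _
  refine ⟨contDiff_iff_contDiffAt.2 fun p => ?_, HasCompactSupport.intro hK fun p hp => hz p hp⟩
  by_cases h : p ∈ K
  · have hn := hΩ.mem_nhds (hKΩ h)
    refine (hH.contDiffAt hn).congr_of_eventuallyEq ?_
    filter_upwards [hn] with q hq
    exact indicator_of_mem hq _
  · refine (contDiffAt_const (c := (0 : ℝ))).congr_of_eventuallyEq ?_
    filter_upwards [hK.isClosed.isOpen_compl.mem_nhds h] with q hq
    exact hz q hq

lemma fderiv_indicator_of_mem {Ω : Set (ℝ × ℝ)} (hΩ : IsOpen Ω) {H : ℝ × ℝ → ℝ} {p : ℝ × ℝ}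
    (hp : p ∈ Ω) : fderiv ℝ (Ω.indicator H) p = fderiv ℝ H p := by
  apply Filter.EventuallyEq.fderiv_eq
  filter_upwards [hΩ.mem_nhds hp] with q hq
  exact indicator_of_mem hq _

/-- Young-type inequality behind the weighted energy estimate. -/
lemma energy_young {ε C wx wy P1 P2 g G G' Gp : ℝ} (hε : 0 < ε) (hε1 : ε ≤ 1)
    (hG0 : 0 ≤ G') (hG1 : G' ≤ 1) (hG : G ^ 2 ≤ 2 * Gp)
    (hP1 : |P1| ≤ C * ε) (hP2 : |P2| ≤ C * ε) :
    ε / 2 * G' * (wx ^ 2 + wy ^ 2) + G ^ 2 / 16 ≤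
      ε * G' * (wx ^ 2 + wy ^ 2) + G' * (wx * P1 + wy * P2) + G * P2 / 2 - G * g
        + (1 - ε / 2) * Gp / 2 + (3 * C ^ 2 * ε + 8 * g ^ 2) := by
  have hq1 : P1 ^ 2 ≤ C ^ 2 * ε * ε := by
    have := sq_le_sq' (neg_le_of_abs_le hP1) (le_of_abs_le hP1); nlinarith
  have hq2 : P2 ^ 2 ≤ C ^ 2 * ε * ε := by
    have := sq_le_sq' (neg_le_of_abs_le hP2) (le_of_abs_le hP2); nlinarith
  have young : ∀ v P : ℝ, P ^ 2 ≤ C ^ 2 * ε * ε → -(v * P) ≤ ε / 2 * v ^ 2 + C ^ 2 * ε / 2 := by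
    intro v P hP
    have h1 : P ^ 2 / ε ≤ C ^ 2 * ε := (div_le_iff₀ hε).2 hP
    have h2 : 0 ≤ (ε * v + P) ^ 2 / ε := by positivity
    have h3 : (ε * v + P) ^ 2 / ε = ε * v ^ 2 + 2 * (v * P) + P ^ 2 / ε := by
      field_simp; ring
    linarith
  have hC : 0 ≤ C ^ 2 * ε := by positivity
  have e1 : G' * -(wx * P1) ≤ ε / 2 * G' * wx ^ 2 + C ^ 2 * ε / 2 := by
    have := mul_le_mul_of_nonneg_left (young wx P1 hq1) hG0
    nlinarith
  have e2 : G' * -(wy * P2) ≤ ε / 2 * G' * wy ^ 2 + C ^ 2 * ε / 2 := by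
    have := mul_le_mul_of_nonneg_left (young wy P2 hq2) hG0
    nlinarith
  have e3 : -(G * P2 / 2) ≤ G ^ 2 / 32 + 2 * P2 ^ 2 := by nlinarith [sq_nonneg (G + 8 * P2)]
  have e4 : G * g ≤ G ^ 2 / 32 + 8 * g ^ 2 := by nlinarith [sq_nonneg (G - 16 * g)]
  have hGp : 0 ≤ Gp := by nlinarith [sq_nonneg G]
  have e5 : G ^ 2 / 8 ≤ (1 - ε / 2) * Gp / 2 := by nlinarith
  have e6 : P2 ^ 2 ≤ C ^ 2 * ε := by nlinarith
  nlinarith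

section Energy

variable {Ω Ωc : Set (ℝ × ℝ)} {b C₁ C₂ ε : ℝ} {w Q₁ Q₂ E : ℝ × ℝ → ℝ}

/-- Energy inequality tested against a truncation of the solution. -/
lemma lintegral_trunc_energy_le (hΩ : IsOpen Ω) (hc : IsCompact Ωc) (hsub : Ω ⊆ Ωc)
    (hb : ∀ p ∈ Ω, |p.2| ≤ b) (hε : 0 < ε) (hε1 : ε ≤ 1)
    (hw : ContDiffOn ℝ 1 w Ω) (hwc : ContinuousOn w Ωc) (hw0 : ∀ p ∈ Ωc, p ∉ Ω → w p = 0)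
    (hQ₁ : ContDiffOn ℝ 1 Q₁ Ω) (hQ₂ : ContDiffOn ℝ 1 Q₂ Ω)
    (hP₁ : ∀ p ∈ Ω, |Q₁ p - ε * fderiv ℝ w p (1, 0)| ≤ C₁ * ε)
    (hP₂ : ∀ p ∈ Ω, |Q₂ p - ε * fderiv ℝ w p (0, 1)| ≤ C₁ * ε)
    (hE : ∀ p ∈ Ω, (fderiv ℝ Q₁ p (1, 0) + fderiv ℝ Q₂ p (0, 1) + fderiv ℝ w p (0, 1)) ^ 2 ≤ E p)
    (hEi : IntegrableOn E Ω) (hEb : ∫ p in Ω, E p ≤ C₂ * ε) {k : ℝ} (hk : 0 < k) :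
    ∫⁻ p in Ω, ENNReal.ofReal (ε / 2 * truncSlope k (w p) *
        (fderiv ℝ w p (1, 0) ^ 2 + fderiv ℝ w p (0, 1) ^ 2) + trunc k (w p) ^ 2 / 16) ≤
      ENNReal.ofReal (exp b * (3 * C₁ ^ 2 * volume.real Ω + 8 * C₂) * ε) := by
  set K : Set (ℝ × ℝ) := Ωc ∩ {p | k ≤ |w p|} with hKdef
  have hKc : IsCompact K := by
    have : IsClosed (Ωc ∩ (fun p => |w p|) ⁻¹' Ici k) :=
      hwc.abs.preimage_isClosed_of_isClosed hc.isClosed isClosed_Ici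
    exact hc.of_isClosed_subset this inter_subset_left
  have hKΩ : K ⊆ Ω := by
    rintro p ⟨hp, hkp⟩
    by_contra hn
    have := hw0 p hp hn
    simp only [mem_ofPred_eq, this, abs_zero] at hkp
    linarith
  have hout : ∀ p ∈ Ω, p ∉ K → |w p| ≤ k := by
    intro p hp hn
    by_contra h
    exact hn ⟨hsub hp, (not_le.1 h).le⟩
  set H₁ : ℝ × ℝ → ℝ := fun p => exp (p.2 / 2) * trunc k (w p) * Q₁ p with hH₁
  set H₂ : ℝ × ℝ → ℝ := fun p => exp (p.2 / 2) * trunc k (w p) * Q₂ p +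
    (1 - ε / 2) * (exp (p.2 / 2) * truncPrim k (w p)) with hH₂
  have hexp : ContDiffOn ℝ 1 (fun p : ℝ × ℝ => exp (p.2 / 2)) Ω := by fun_prop
  have hG : ContDiffOn ℝ 1 (fun p => trunc k (w p)) Ω := (contDiff_trunc k).comp_contDiffOn hw
  have hGp : ContDiffOn ℝ 1 (fun p => truncPrim k (w p)) Ω :=
    (contDiff_truncPrim k).comp_contDiffOn hw
  obtain ⟨hX₁, hX₁c⟩ := contDiff_indicator_of_eq_zero hΩ hKc hKΩ
    (H := H₁) ((hexp.mul hG).mul hQ₁) fun p hp hn => by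
      simp [hH₁, trunc_eq_zero hk (hout p hp hn)]
  obtain ⟨hX₂, hX₂c⟩ := contDiff_indicator_of_eq_zero hΩ hKc hKΩ
    (H := H₂) (((hexp.mul hG).mul hQ₂).add (contDiffOn_const.mul (hexp.mul hGp)))
    fun p hp hn => by
      simp [hH₂, trunc_eq_zero hk (hout p hp hn), truncPrim_eq_zero hk (hout p hp hn)]
  obtain ⟨hi₁, hz₁⟩ := integral_fderiv_apply_eq_zero hX₁ hX₁c (1, 0)
  obtain ⟨hi₂, hz₂⟩ := integral_fderiv_apply_eq_zero hX₂ hX₂c (0, 1)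
  set d : ℝ × ℝ → ℝ := fun p =>
    fderiv ℝ (Ω.indicator H₁) p (1, 0) + fderiv ℝ (Ω.indicator H₂) p (0, 1) with hd
  have hdi : Integrable d := hi₁.add hi₂
  have hdz : ∫ p in Ω, d p = 0 := by
    rw [setIntegral_eq_integral_of_forall_compl_eq_zero, hd, integral_add hi₁ hi₂, hz₁, hz₂,
      add_zero]
    intro p hp
    have hpK : p ∉ K := fun h => hp (hKΩ h)
    have h1 : ∀ H : ℝ × ℝ → ℝ, (∀ q ∈ Ω, q ∉ K → H q = 0) →
        fderiv ℝ (Ω.indicator H) p = 0 := by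
      intro H hH
      have : Ω.indicator H =ᶠ[𝓝 p] fun _ => (0 : ℝ) := by
        filter_upwards [hKc.isClosed.isOpen_compl.mem_nhds hpK] with q hq
        by_cases h : q ∈ Ω
        · rw [indicator_of_mem h]; exact hH q h hq
        · exact indicator_of_notMem h _
      rw [this.fderiv_eq]; simp
    simp only [hd]
    rw [h1 H₁ fun p hp hn => by simp [hH₁, trunc_eq_zero hk (hout p hp hn)],
      h1 H₂ fun p hp hn => by
        simp [hH₂, trunc_eq_zero hk (hout p hp hn), truncPrim_eq_zero hk (hout p hp hn)]]
    simp
  have hpt : ∀ p ∈ Ω, ε / 2 * truncSlope k (w p) *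
        (fderiv ℝ w p (1, 0) ^ 2 + fderiv ℝ w p (0, 1) ^ 2) + trunc k (w p) ^ 2 / 16 ≤
      exp (b / 2) * d p + exp b * (3 * C₁ ^ 2 * ε + 8 * E p) := by
    intro p hp
    have hn := hΩ.mem_nhds hp
    have dw := ((hw.contDiffAt hn).differentiableAt one_ne_zero).hasFDerivAt
    have dQ₁ := ((hQ₁.contDiffAt hn).differentiableAt one_ne_zero).hasFDerivAt
    have dQ₂ := ((hQ₂.contDiffAt hn).differentiableAt one_ne_zero).hasFDerivAt
    have dG := (hasDerivAt_trunc k (w p)).comp_hasFDerivAt p dw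
    have dGp := (hasDerivAt_truncPrim k (w p)).comp_hasFDerivAt p dw
    have de : HasFDerivAt (fun p : ℝ × ℝ => exp (p.2 / 2))
        (exp (p.2 / 2) • ((1 / 2 : ℝ) • ContinuousLinearMap.snd ℝ ℝ ℝ)) p := by
      have h2 : HasFDerivAt (fun p : ℝ × ℝ => p.2 / 2)
          ((1 / 2 : ℝ) • ContinuousLinearMap.snd ℝ ℝ ℝ) p := by
        have := (hasFDerivAt_snd (𝕜 := ℝ) (p := p)).const_mul (1 / 2 : ℝ)
        refine this.congr_of_eventuallyEq (Filter.Eventually.of_forall fun q => ?_)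
        simp; ring
      exact h2.exp
    have d1 := (de.mul dG).mul dQ₁
    have d2 := ((de.mul dG).mul dQ₂).add ((de.mul dGp).const_mul (1 - ε / 2))
    have hdp : d p = fderiv ℝ H₁ p (1, 0) + fderiv ℝ H₂ p (0, 1) := by
      simp only [hd, fderiv_indicator_of_mem hΩ hp]
    have e1 : fderiv ℝ H₁ p = _ := d1.fderiv
    have e2 : fderiv ℝ H₂ p = _ := d2.fderiv
    have hd' : d p = exp (p.2 / 2) * (ε * truncSlope k (w p) *
          (fderiv ℝ w p (1, 0) ^ 2 + fderiv ℝ w p (0, 1) ^ 2) +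
        truncSlope k (w p) * (fderiv ℝ w p (1, 0) * (Q₁ p - ε * fderiv ℝ w p (1, 0)) +
          fderiv ℝ w p (0, 1) * (Q₂ p - ε * fderiv ℝ w p (0, 1))) +
        trunc k (w p) * (Q₂ p - ε * fderiv ℝ w p (0, 1)) / 2 -
        trunc k (w p) *
          -(fderiv ℝ Q₁ p (1, 0) + fderiv ℝ Q₂ p (0, 1) + fderiv ℝ w p (0, 1)) +
        (1 - ε / 2) * truncPrim k (w p) / 2) := by
      rw [hdp, e1, e2]
      simp
      ring
    have hy := energy_young (wx := fderiv ℝ w p (1, 0)) (wy := fderiv ℝ w p (0, 1))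
      (g := -(fderiv ℝ Q₁ p (1, 0) + fderiv ℝ Q₂ p (0, 1) + fderiv ℝ w p (0, 1)))
      hε hε1 (truncSlope_nonneg k (w p))
      (truncSlope_le_one k (w p)) (trunc_sq_le k (w p)) (hP₁ p hp) (hP₂ p hp)
    set N := ε / 2 * truncSlope k (w p) *
        (fderiv ℝ w p (1, 0) ^ 2 + fderiv ℝ w p (0, 1) ^ 2) + trunc k (w p) ^ 2 / 16 with hN
    have hN0 : 0 ≤ N := by have := truncSlope_nonneg k (w p); positivity
    have hEp := hE p hp
    have hE0 : 0 ≤ E p := (sq_nonneg _).trans hEp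
    have hy2 : exp (p.2 / 2) * N ≤ d p + exp (p.2 / 2) * (3 * C₁ ^ 2 * ε + 8 * E p) := by
      rw [hd', ← mul_add]
      refine mul_le_mul_of_nonneg_left (hy.trans ?_) (exp_pos _).le
      rw [neg_sq]; linarith
    have hbp := abs_le.1 (hb p hp)
    have h1 : 1 ≤ exp (b / 2) * exp (p.2 / 2) := by
      rw [← exp_add]; exact one_le_exp (by linarith)
    have h2 : exp (b / 2) * exp (p.2 / 2) ≤ exp b := by
      rw [← exp_add]; exact exp_le_exp.2 (by linarith)
    calc N ≤ exp (b / 2) * (exp (p.2 / 2) * N) := by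
            rw [← mul_assoc]; exact le_mul_of_one_le_left hN0 h1
      _ ≤ exp (b / 2) * (d p + exp (p.2 / 2) * (3 * C₁ ^ 2 * ε + 8 * E p)) :=
            mul_le_mul_of_nonneg_left hy2 (exp_pos _).le
      _ = exp (b / 2) * d p + exp (b / 2) * exp (p.2 / 2) * (3 * C₁ ^ 2 * ε + 8 * E p) := by ring
      _ ≤ _ := by gcongr
  have hfin : volume Ω ≠ ⊤ := ((measure_mono hsub).trans_lt hc.measure_lt_top).ne
  have hci : IntegrableOn (fun _ : ℝ × ℝ => 3 * C₁ ^ 2 * ε) Ω :=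
    integrableOn_const hfin
  have hsi : IntegrableOn (fun p => exp b * (3 * C₁ ^ 2 * ε + 8 * E p)) Ω :=
    (hci.add (hEi.const_mul 8)).const_mul _
  have hri : IntegrableOn
      (fun p => exp (b / 2) * d p + exp b * (3 * C₁ ^ 2 * ε + 8 * E p)) Ω :=
    (hdi.integrableOn.const_mul _).add hsi
  calc _ ≤ ∫⁻ p in Ω, ENNReal.ofReal
        (exp (b / 2) * d p + exp b * (3 * C₁ ^ 2 * ε + 8 * E p)) :=
        setLIntegral_mono' hΩ.measurableSet fun p hp => ENNReal.ofReal_le_ofReal (hpt p hp)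
    _ = ENNReal.ofReal (∫ p in Ω,
        (exp (b / 2) * d p + exp b * (3 * C₁ ^ 2 * ε + 8 * E p))) := by
        refine (ofReal_integral_eq_lintegral_ofReal hri ?_).symm
        rw [Filter.EventuallyLE, ae_restrict_iff' hΩ.measurableSet]
        refine Filter.Eventually.of_forall fun p hp => le_trans ?_ (hpt p hp)
        have := truncSlope_nonneg k (w p)
        simp only [Pi.zero_apply]
        positivity
    _ ≤ _ := by
        refine ENNReal.ofReal_le_ofReal ?_
        rw [integral_add (hdi.integrableOn.const_mul _) hsi, integral_const_mul, integral_const_mul, hdz,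
          integral_add hci (hEi.const_mul 8)]
        simp only [setIntegral_const, smul_eq_mul, mul_zero, zero_add]
        rw [mul_assoc (exp b)]
        refine mul_le_mul_of_nonneg_left ?_ (exp_pos b).le
        have h8 : ∫ p in Ω, 8 * E p = 8 * ∫ p in Ω, E p := integral_const_mul _ _
        linarith

/-- Energy estimate for a solution of a convection–diffusion inequality in divergence form that
vanishes on the boundary. -/
lemma lintegral_energy_le (hΩ : IsOpen Ω) (hc : IsCompact Ωc) (hsub : Ω ⊆ Ωc)
    (hb : ∀ p ∈ Ω, |p.2| ≤ b) (hε : 0 < ε) (hε1 : ε ≤ 1)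
    (hw : ContDiffOn ℝ 1 w Ω) (hwc : ContinuousOn w Ωc) (hw0 : ∀ p ∈ Ωc, p ∉ Ω → w p = 0)
    (hQ₁ : ContDiffOn ℝ 1 Q₁ Ω) (hQ₂ : ContDiffOn ℝ 1 Q₂ Ω)
    (hP₁ : ∀ p ∈ Ω, |Q₁ p - ε * fderiv ℝ w p (1, 0)| ≤ C₁ * ε)
    (hP₂ : ∀ p ∈ Ω, |Q₂ p - ε * fderiv ℝ w p (0, 1)| ≤ C₁ * ε)
    (hE : ∀ p ∈ Ω, (fderiv ℝ Q₁ p (1, 0) + fderiv ℝ Q₂ p (0, 1) + fderiv ℝ w p (0, 1)) ^ 2 ≤ E p)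
    (hEi : IntegrableOn E Ω) (hEb : ∫ p in Ω, E p ≤ C₂ * ε) :
    ∫⁻ p in Ω, ENNReal.ofReal (ε / 2 *
        (fderiv ℝ w p (1, 0) ^ 2 + fderiv ℝ w p (0, 1) ^ 2) + w p ^ 2 / 16) ≤
      ENNReal.ofReal (exp b * (3 * C₁ ^ 2 * volume.real Ω + 8 * C₂) * ε) := by
  set N : ℝ → ℝ × ℝ → ℝ := fun k p => ε / 2 * truncSlope k (w p) *
        (fderiv ℝ w p (1, 0) ^ 2 + fderiv ℝ w p (0, 1) ^ 2) + trunc k (w p) ^ 2 / 16 with hN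
  have hcf : ContinuousOn (fun p => fderiv ℝ w p) Ω :=
    hw.continuousOn_fderiv_of_isOpen hΩ le_rfl
  have hNc : ∀ k, ContinuousOn (N k) Ω := by
    intro k
    have h1 : ∀ v : ℝ × ℝ, ContinuousOn (fun p => fderiv ℝ w p v) Ω :=
      fun v => hcf.clm_apply continuousOn_const
    have h2 := (continuous_truncSlope k).comp_continuousOn hw.continuousOn
    have h3 := (continuous_trunc k).comp_continuousOn hw.continuousOn
    exact ((continuousOn_const.mul h2).mul (((h1 _).pow 2).add ((h1 _).pow 2))).add
      ((h3.pow 2).div_const _)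
  set k : ℕ → ℝ := fun n => 1 / ((n : ℝ) + 1) with hkdef
  have hk : ∀ n, 0 < k n := fun n => by positivity
  have hk0 : Filter.Tendsto k Filter.atTop (𝓝 0) := tendsto_one_div_add_atTop_nhds_zero_nat
  have hlim : ∀ᵐ p ∂(volume.restrict Ω), ENNReal.ofReal (ε / 2 *
        (fderiv ℝ w p (1, 0) ^ 2 + fderiv ℝ w p (0, 1) ^ 2) + w p ^ 2 / 16) ≤
      Filter.liminf (fun n => ENNReal.ofReal (N (k n) p)) Filter.atTop := by
    filter_upwards [ae_fderiv_eq_zero_of_eq_zero hΩ hw] with p hp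
    by_cases h0 : w p = 0
    · obtain ⟨h1, h2⟩ := hp h0
      simp [h0, h1, h2]
    · set T := ε / 2 * (fderiv ℝ w p (1, 0) ^ 2 + fderiv ℝ w p (0, 1) ^ 2) with hT
      have ht : Filter.Tendsto (fun n => ENNReal.ofReal (T + (|w p| - 2 * k n) ^ 2 / 16))
          Filter.atTop (𝓝 (ENNReal.ofReal (T + (|w p| - 2 * 0) ^ 2 / 16))) := by
        refine (ENNReal.continuous_ofReal.tendsto _).comp ?_
        exact tendsto_const_nhds.add
          (((tendsto_const_nhds.sub (hk0.const_mul 2)).pow 2).div_const 16)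
      rw [mul_zero, sub_zero, sq_abs] at ht
      rw [← ht.liminf_eq]
      refine Filter.liminf_le_liminf ?_
      have hev : ∀ᶠ n in Filter.atTop, k n < |w p| / 2 :=
        hk0.eventually_lt_const (by positivity)
      filter_upwards [hev] with n hn
      refine ENNReal.ofReal_le_ofReal ?_
      simp only [hN]
      rw [truncSlope_eq_one (hk n) (by linarith), mul_one]
      have h3 : (|w p| - 2 * k n) ^ 2 ≤ trunc (k n) (w p) ^ 2 := by
        rw [← sq_abs (trunc (k n) (w p))]
        exact pow_le_pow_left₀ (by linarith) (abs_sub_two_mul_le_abs_trunc (hk n)) 2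
      linarith
  refine (lintegral_mono_ae hlim).trans ?_
  refine (lintegral_liminf_le' fun n => ?_).trans ?_
  · exact ((hNc (k n)).aestronglyMeasurable hΩ.measurableSet).aemeasurable.ennreal_ofReal
  · refine Filter.liminf_le_of_frequently_le' (Filter.Frequently.of_forall fun n => ?_)
    exact lintegral_trunc_energy_le hΩ hc hsub hb hε hε1 hw hwc hw0 hQ₁ hQ₂ hP₁ hP₂ hE hEi hEb
      (hk n)

end Energy

/-- Squared profile of the boundary layer along the lower part of the ellipse. -/
noncomputable def layerProfile (A B ε : ℝ) (p : ℝ × ℝ) : ℝ :=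
  if p.2 < 0 then
    p.2 ^ 2 * exp (p.2 * (1 - p.1 ^ 2 / A ^ 2 - p.2 ^ 2 / B ^ 2) / (2 * ε)) else 0

lemma measurable_layerProfile (A B ε : ℝ) : Measurable (layerProfile A B ε) := by
  unfold layerProfile
  exact Measurable.ite (measurableSet_lt measurable_snd measurable_const)
    (by fun_prop) measurable_const

lemma layerProfile_nonneg (A B ε : ℝ) (p : ℝ × ℝ) : 0 ≤ layerProfile A B ε p := by
  unfold layerProfile; split_ifs <;> positivity

lemma layer_slice_le {κ Y y : ℝ} (hκ : 0 < κ) (hy : y ∈ Icc (-Y) 0) :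
    y ^ 2 * exp (κ * (y * (Y ^ 2 - y ^ 2))) ≤
      Y * (-y) * exp (-(κ * (Y / 2) * (Y ^ 2 - y ^ 2))) + y ^ 2 * exp (3 * κ * y ^ 3) := by
  obtain ⟨h1, h2⟩ := hy
  have hY : 0 ≤ Y := by linarith
  have hd : 0 ≤ Y ^ 2 - y ^ 2 := by nlinarith
  rcases le_total y (-(Y / 2)) with h | h
  · have e1 : exp (κ * (y * (Y ^ 2 - y ^ 2))) ≤ exp (-(κ * (Y / 2) * (Y ^ 2 - y ^ 2))) := by
      apply exp_le_exp.2
      nlinarith [mul_nonneg hκ.le hd]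
    have e2 : y ^ 2 ≤ Y * (-y) := by nlinarith
    have : y ^ 2 * exp (κ * (y * (Y ^ 2 - y ^ 2))) ≤
        Y * (-y) * exp (-(κ * (Y / 2) * (Y ^ 2 - y ^ 2))) := by gcongr; nlinarith
    have : 0 ≤ y ^ 2 * exp (3 * κ * y ^ 3) := by positivity
    linarith
  · have e1 : exp (κ * (y * (Y ^ 2 - y ^ 2))) ≤ exp (3 * κ * y ^ 3) := by
      apply exp_le_exp.2
      have h4 : 0 ≤ Y ^ 2 - 4 * y ^ 2 := by nlinarith
      have := mul_nonneg (mul_nonneg hκ.le (neg_nonneg.2 h2)) h4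
      nlinarith
    have : y ^ 2 * exp (κ * (y * (Y ^ 2 - y ^ 2))) ≤ y ^ 2 * exp (3 * κ * y ^ 3) := by gcongr
    have : 0 ≤ Y * (-y) * exp (-(κ * (Y / 2) * (Y ^ 2 - y ^ 2))) :=
      mul_nonneg (mul_nonneg hY (by linarith)) (exp_pos _).le
    linarith

lemma lintegral_layer_slice_le {κ Y : ℝ} (hκ : 0 < κ) (hY : 0 ≤ Y) :
    ∫⁻ y in Icc (-Y) 0, ENNReal.ofReal (y ^ 2 * exp (κ * (y * (Y ^ 2 - y ^ 2)))) ≤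
      ENNReal.ofReal (2 / κ) := by
  set h : ℝ → ℝ := fun y =>
    Y * (-y) * exp (-(κ * (Y / 2) * (Y ^ 2 - y ^ 2))) + y ^ 2 * exp (3 * κ * y ^ 3) with hh
  set F : ℝ → ℝ := fun y =>
    -(exp (-(κ * (Y / 2) * (Y ^ 2 - y ^ 2))) / κ) + exp (3 * κ * y ^ 3) / (9 * κ) with hF
  have hcont : Continuous h := by fun_prop
  have hder : ∀ y, HasDerivAt F (h y) y := by
    intro y
    have h1 : HasDerivAt (fun y : ℝ => -(κ * (Y / 2) * (Y ^ 2 - y ^ 2))) (κ * Y * y) y := by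
      have := (((hasDerivAt_id y).fun_pow 2).const_sub (Y ^ 2)).const_mul (κ * (Y / 2)) |>.fun_neg
      simp only [id] at this
      refine this.congr_deriv ?_
      simp; ring
    have h2 : HasDerivAt (fun y : ℝ => 3 * κ * y ^ 3) (9 * κ * y ^ 2) y := by
      have := ((hasDerivAt_id y).fun_pow 3).const_mul (3 * κ)
      simp only [id] at this
      refine this.congr_deriv ?_
      simp; ring
    have := (h1.exp.div_const κ).fun_neg.fun_add (h2.exp.div_const (9 * κ))
    refine this.congr_deriv ?_
    simp only [hh]
    field_simp
  have hi : IntegrableOn h (Icc (-Y) 0) := hcont.integrableOn_Icc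
  calc _ ≤ ∫⁻ y in Icc (-Y) 0, ENNReal.ofReal (h y) :=
        setLIntegral_mono' measurableSet_Icc fun y hy =>
          ENNReal.ofReal_le_ofReal (layer_slice_le hκ hy)
    _ = ENNReal.ofReal (∫ y in Icc (-Y) 0, h y) := by
        refine (ofReal_integral_eq_lintegral_ofReal hi ?_).symm
        rw [Filter.EventuallyLE, ae_restrict_iff' measurableSet_Icc]
        refine Filter.Eventually.of_forall fun y hy => ?_
        refine le_trans ?_ (layer_slice_le hκ hy)
        simp only [Pi.zero_apply]; positivity
    _ ≤ _ := by
        refine ENNReal.ofReal_le_ofReal ?_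
        rw [integral_Icc_eq_integral_Ioc, ← intervalIntegral.integral_of_le (by linarith),
          intervalIntegral.integral_eq_sub_of_hasDerivAt (fun y _ => hder y)
            (hcont.intervalIntegrable _ _)]
        simp only [hF]
        have e1 : (-Y) ^ 2 = Y ^ 2 := by ring
        rw [e1]
        simp only [sub_self, mul_zero, neg_zero, exp_zero, ne_eq, OfNat.ofNat_ne_zero,
          not_false_eq_true, zero_pow]
        have p1 := exp_pos (-(κ * (Y / 2) * (Y ^ 2 - 0)))
        have p2 := exp_pos (3 * κ * (-Y) ^ 3)
        have p3 := div_pos p1 hκ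
        have p4 := div_pos p2 (show (0 : ℝ) < 9 * κ by positivity)
        have p5 : 1 / (9 * κ) = 1 / κ / 9 := by field_simp
        have p6 : 2 / κ = 2 * (1 / κ) := by ring
        have p7 : 0 < 1 / κ := by positivity
        rw [p5, p6]
        linarith

/-- The boundary-layer profile has `L¹` norm of order `ε`. -/
lemma integral_layerProfile_le {A B ε : ℝ} (hA : 0 < A) (hB : 0 < B) (hε : 0 < ε)
    {Ω : Set (ℝ × ℝ)} (hΩ : Ω = {p : ℝ × ℝ | p.1 ^ 2 / A ^ 2 + p.2 ^ 2 / B ^ 2 < 1})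
    (hΩm : MeasurableSet Ω) :
    IntegrableOn (layerProfile A B ε) Ω ∧
      ∫ p in Ω, layerProfile A B ε p ≤ 8 * A * B ^ 2 * ε := by
  have key : ∫⁻ p in Ω, ENNReal.ofReal (layerProfile A B ε p) ≤
      ENNReal.ofReal (8 * A * B ^ 2 * ε) := by
    rw [← lintegral_indicator hΩm, Measure.volume_eq_prod, lintegral_prod _
      (((measurable_layerProfile A B ε).ennreal_ofReal.indicator hΩm).aemeasurable)]
    have hin : ∀ x, ∫⁻ y, Ω.indicator (fun p => ENNReal.ofReal (layerProfile A B ε p)) (x, y) ≤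
        (Icc (-A) A).indicator (fun _ => ENNReal.ofReal (4 * B ^ 2 * ε)) x := by
      intro x
      by_cases hx : x ∈ Icc (-A) A
      · rw [indicator_of_mem hx]
        have hx1 : x ^ 2 / A ^ 2 ≤ 1 := by
          rw [div_le_one (by positivity)]; nlinarith [hx.1, hx.2]
        set Y := B * √(1 - x ^ 2 / A ^ 2) with hY
        have hY0 : 0 ≤ Y := by positivity
        have hY2 : Y ^ 2 = B ^ 2 * (1 - x ^ 2 / A ^ 2) := by
          rw [hY, mul_pow, sq_sqrt (by linarith)]
        have hs := lintegral_layer_slice_le (κ := 1 / (2 * B ^ 2 * ε)) (by positivity) hY0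
        rw [← lintegral_indicator measurableSet_Icc] at hs
        have e : 2 / (1 / (2 * B ^ 2 * ε)) = 4 * B ^ 2 * ε := by field_simp; norm_num
        rw [e] at hs
        refine (lintegral_mono fun y => ?_).trans hs
        by_cases hp : (x, y) ∈ Ω
        · rw [indicator_of_mem hp]
          rw [hΩ] at hp
          have hp' : x ^ 2 / A ^ 2 + y ^ 2 / B ^ 2 < 1 := hp
          by_cases hy : y < 0
          · have hyY : y ^ 2 < Y ^ 2 := by
              rw [hY2]
              have : y ^ 2 / B ^ 2 < 1 - x ^ 2 / A ^ 2 := by linarith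
              rw [div_lt_iff₀ (by positivity)] at this
              linarith
            have hyI : y ∈ Icc (-Y) 0 := ⟨(abs_le_of_sq_le_sq' hyY.le hY0).1, hy.le⟩
            rw [indicator_of_mem hyI]
            refine ENNReal.ofReal_le_ofReal (le_of_eq ?_)
            simp only [layerProfile, hy, if_true]
            rw [hY2]
            congr 2
            field_simp
          · simp [layerProfile, hy]
        · rw [indicator_of_notMem hp]; exact zero_le
      · rw [indicator_of_notMem hx]
        refine (lintegral_congr fun y => ?_).trans_le lintegral_zero.le
        refine indicator_of_notMem (fun hp => hx ?_) _
        rw [hΩ] at hp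
        have hp' : x ^ 2 / A ^ 2 + y ^ 2 / B ^ 2 < 1 := hp
        have h1 : x ^ 2 / A ^ 2 ≤ 1 := by
          have : 0 ≤ y ^ 2 / B ^ 2 := by positivity
          linarith
        rw [div_le_one (by positivity)] at h1
        exact abs_le_of_sq_le_sq' h1 hA.le
    refine (lintegral_mono hin).trans ?_
    rw [lintegral_indicator measurableSet_Icc, setLIntegral_const, Real.volume_Icc,
      ← ENNReal.ofReal_mul (by positivity)]
    exact ENNReal.ofReal_le_ofReal (by nlinarith)
  have hm := (measurable_layerProfile A B ε).aestronglyMeasurable (μ := volume.restrict Ω)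
  have h0 : 0 ≤ᵐ[volume.restrict Ω] layerProfile A B ε :=
    Filter.Eventually.of_forall fun p => layerProfile_nonneg A B ε p
  refine ⟨⟨hm, ?_⟩, ?_⟩
  · rw [hasFiniteIntegral_iff_ofReal h0]
    exact key.trans_lt ENNReal.ofReal_lt_top
  · rw [integral_eq_lintegral_of_nonneg_ae h0 hm]
    exact ENNReal.toReal_le_of_le_ofReal (by positivity) key

/-- Differentiation under the integral sign over a compact interval. -/
lemma contDiff_one_intervalIntegral {E : Type*} [NormedAddCommGroup E] [NormedSpace ℝ E]
    [ProperSpace E] {F : E × ℝ → ℝ} (hF : ContDiff ℝ 1 F) (α β : ℝ) :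
    ContDiff ℝ 1 fun p => ∫ t in α..β, F (p, t) := by
  set F' : E → ℝ → E →L[ℝ] ℝ := fun p t =>
    (fderiv ℝ F (p, t)).comp (ContinuousLinearMap.inl ℝ E ℝ) with hF'
  have hF'c : Continuous (Function.uncurry F') := by
    have : Continuous fun q : E × ℝ => fderiv ℝ F q := hF.continuous_fderiv one_ne_zero
    exact this.clm_comp continuous_const
  have hd : ∀ p t, HasFDerivAt (fun p => F (p, t)) (F' p t) p := fun p t =>
    ((hF.differentiable one_ne_zero (p, t)).hasFDerivAt).comp p (hasFDerivAt_prodMk_left p t)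
  have hmain : ∀ p, HasFDerivAt (fun p => ∫ t in α..β, F (p, t)) (∫ t in α..β, F' p t) p := by
    intro p
    obtain ⟨C, hC⟩ := ((isCompact_closedBall p 1).prod (isCompact_uIcc (a := α) (b := β))
      ).exists_bound_of_continuousOn hF'c.continuousOn
    have hFc : ∀ p, Continuous fun t => F (p, t) := fun p => hF.continuous.comp (by fun_prop)
    refine intervalIntegral.hasFDerivAt_integral_of_dominated_of_fderiv_le (μ := volume)
      (bound := fun _ => C) (F' := F')
      (Metric.closedBall_mem_nhds p one_pos) (Filter.Eventually.of_forall fun p =>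
        (hFc p).aestronglyMeasurable) ((hFc p).intervalIntegrable _ _)
      (hF'c.comp (by fun_prop : Continuous fun t : ℝ => (p, t))).aestronglyMeasurable
      (Filter.Eventually.of_forall fun t ht x hx => hC (x, t) ⟨hx, uIoc_subset_uIcc ht⟩)
      intervalIntegrable_const (Filter.Eventually.of_forall fun t _ x _ => hd x t)
  rw [contDiff_one_iff_fderiv]
  refine ⟨fun p => (hmain p).differentiableAt, ?_⟩
  rw [show fderiv ℝ (fun p => ∫ t in α..β, F (p, t)) = fun p => ∫ t in α..β, F' p t from
    funext fun p => (hmain p).fderiv]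
  exact intervalIntegral.continuous_parametric_intervalIntegral_of_continuous' hF'c α β

lemma contDiff_one_scaled_integral {f : ℝ × ℝ → ℝ} (hf : ContDiff ℝ 1 f) (α β : ℝ) :
    ContDiff ℝ 1 fun p : ℝ × ℝ => ∫ t in α..β, f (p.1, p.2 * t) :=
  contDiff_one_intervalIntegral (F := fun q : (ℝ × ℝ) × ℝ => f (q.1.1, q.1.2 * q.2))
    (by fun_prop) α β

/-- The primitive in the second variable of a `C¹` function is `C¹`. -/
lemma contDiff_one_primitive {f : ℝ × ℝ → ℝ} (hf : ContDiff ℝ 1 f) :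
    ContDiff ℝ 1 fun p : ℝ × ℝ => ∫ t in (0 : ℝ)..p.2, f (p.1, t) := by
  have : (fun p : ℝ × ℝ => ∫ t in (0 : ℝ)..p.2, f (p.1, t)) =
      fun p => p.2 * ∫ t in (0 : ℝ)..1, f (p.1, p.2 * t) := by
    funext p
    rw [intervalIntegral.mul_integral_comp_mul_left (f := fun t => f (p.1, t))]
    simp
  rw [this]
  exact contDiff_snd.mul (contDiff_one_scaled_integral hf 0 1)

lemma fderiv_primitive_snd {f : ℝ × ℝ → ℝ} (hf : ContDiff ℝ 1 f) (p : ℝ × ℝ) :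
    fderiv ℝ (fun p : ℝ × ℝ => ∫ t in (0 : ℝ)..p.2, f (p.1, t)) p (0, 1) = f p := by
  have h1 := ((contDiff_one_primitive hf).differentiable one_ne_zero p).hasFDerivAt
  have h2 : HasDerivAt (fun y : ℝ => (p.1, y)) ((0 : ℝ), (1 : ℝ)) p.2 :=
    (hasDerivAt_const _ _).prodMk (hasDerivAt_id _)
  have h3 := h1.comp_hasDerivAt p.2 h2
  have hc : Continuous fun t => f (p.1, t) := hf.continuous.comp (by fun_prop)
  have h4 := intervalIntegral.integral_hasDerivAt_right (hc.intervalIntegrable 0 p.2)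
    hc.aestronglyMeasurable.stronglyMeasurableAtFilter hc.continuousAt
  exact h3.unique h4

/-- A `C¹` function vanishing at `(±A, 0)` is controlled by the distance to these points. -/
lemma exists_abs_le_of_eq_zero {g : ℝ × ℝ → ℝ} (hg : ContDiff ℝ 1 g) {A B : ℝ}
    (h1 : g (A, 0) = 0) (h2 : g (-A, 0) = 0) :
    ∃ L, 0 ≤ L ∧ ∀ x y, |x| ≤ A → |y| ≤ B → |g (x, y)| ≤ L * (A - |x| + |y|) := by
  obtain ⟨L, hL⟩ := ((isCompact_Icc (a := -A) (b := A)).prod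
    (isCompact_Icc (a := -B) (b := B))).exists_bound_of_continuousOn
    (hg.continuous_fderiv one_ne_zero).continuousOn
  have key : ∀ x y x₀, |x| ≤ A → |y| ≤ B → |x₀| ≤ A → g (x₀, 0) = 0 →
      |g (x, y)| ≤ |L| * (|x - x₀| + |y|) := by
    intro x y x₀ hx hy hx₀ h0
    have hcv : Convex ℝ (Icc (-A) A ×ˢ Icc (-B) B) := (convex_Icc _ _).prod (convex_Icc _ _)
    have hB : 0 ≤ B := (abs_nonneg _).trans hy
    have := hcv.norm_image_sub_le_of_norm_fderiv_le (𝕜 := ℝ) (f := g) (C := |L|)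
      (fun z _ => hg.differentiable one_ne_zero z) (fun z hz => (hL z hz).trans (le_abs_self L))
      (x := (x₀, 0)) (y := (x, y)) ⟨abs_le.1 hx₀, by simp [hB]⟩ ⟨abs_le.1 hx, abs_le.1 hy⟩
    rw [h0, sub_zero, norm_eq_abs] at this
    refine this.trans (mul_le_mul_of_nonneg_left ?_ (abs_nonneg _))
    simp only [Prod.mk_sub_mk, Prod.norm_mk, norm_eq_abs, sub_zero]
    exact max_le_add_of_nonneg (abs_nonneg _) (abs_nonneg _)
  refine ⟨|L|, abs_nonneg _, fun x y hx hy => ?_⟩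
  have hA : 0 ≤ A := (abs_nonneg _).trans hx
  rcases le_total 0 x with h | h
  · have := key x y A hx hy (abs_of_nonneg hA).le h1
    rwa [abs_sub_comm, abs_of_nonneg (by linarith [le_abs_self x] : 0 ≤ A - x),
      show A - x = A - |x| by rw [abs_of_nonneg h]] at this
  · have := key x y (-A) hx hy (by rw [abs_neg, abs_of_nonneg hA]) h2
    rwa [abs_of_nonneg (by linarith [neg_abs_le x] : 0 ≤ x - -A),
      show x - -A = A - |x| by rw [abs_of_nonpos h]; ring] at this

lemma abs_le_of_ellipse {A B : ℝ} (hA : 0 < A) (hB : 0 < B) {p : ℝ × ℝ}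
    (hp : p.1 ^ 2 / A ^ 2 + p.2 ^ 2 / B ^ 2 ≤ 1) : |p.1| ≤ A ∧ |p.2| ≤ B := by
  have h1 : 0 ≤ p.1 ^ 2 / A ^ 2 := by positivity
  have h2 : 0 ≤ p.2 ^ 2 / B ^ 2 := by positivity
  constructor
  · have : p.1 ^ 2 / A ^ 2 ≤ 1 := by linarith
    rw [div_le_one (by positivity)] at this
    exact abs_le_of_sq_le_sq this hA.le
  · have : p.2 ^ 2 / B ^ 2 ≤ 1 := by linarith
    rw [div_le_one (by positivity)] at this
    exact abs_le_of_sq_le_sq this hB.le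

section LimitSolution

variable {A B : ℝ} {f u0 : ℝ × ℝ → ℝ}

lemma limitSolution_eq (hf : ContDiff ℝ 1 f)
    (hu0 : ∀ p : ℝ × ℝ, u0 p = ∫ s in p.2..(B * √(1 - p.1 ^ 2 / A ^ 2)), f (p.1, s)) :
    u0 = fun p => (fun p : ℝ × ℝ => ∫ t in (0 : ℝ)..p.2, f (p.1, t))
      (p.1, B * √(1 - p.1 ^ 2 / A ^ 2)) - ∫ t in (0 : ℝ)..p.2, f (p.1, t) := by
  funext p
  have hc : Continuous fun t => f (p.1, t) := hf.continuous.comp (by fun_prop)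
  rw [hu0, intervalIntegral.integral_interval_sub_left (hc.intervalIntegrable _ _)
    (hc.intervalIntegrable _ _)]

lemma continuous_limitSolution (hf : ContDiff ℝ 1 f)
    (hu0 : ∀ p : ℝ × ℝ, u0 p = ∫ s in p.2..(B * √(1 - p.1 ^ 2 / A ^ 2)), f (p.1, s)) :
    Continuous u0 := by
  rw [limitSolution_eq hf hu0]
  have hP := (contDiff_one_primitive hf).continuous
  refine Continuous.sub (hP.comp (by fun_prop)) hP

lemma limitSolution_eq_zero (hB : 0 < B)
    (hu0 : ∀ p : ℝ × ℝ, u0 p = ∫ s in p.2..(B * √(1 - p.1 ^ 2 / A ^ 2)), f (p.1, s))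
    {p : ℝ × ℝ} (hp : p.1 ^ 2 / A ^ 2 + p.2 ^ 2 / B ^ 2 = 1) (hy : 0 ≤ p.2) : u0 p = 0 := by
  have : 1 - p.1 ^ 2 / A ^ 2 = (p.2 / B) ^ 2 := by rw [div_pow]; linarith
  rw [hu0, this, sqrt_sq (by positivity), mul_div_cancel₀ _ hB.ne']
  simp

/-- On the lower half of the ellipse the limit solution is an integral between symmetric points. -/
lemma limitSolution_lower (hA : 0 < A)
    (hu0 : ∀ p : ℝ × ℝ, u0 p = ∫ s in p.2..(B * √(1 - p.1 ^ 2 / A ^ 2)), f (p.1, s))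
    {c s : ℝ} (h : c ^ 2 + s ^ 2 = 1) (hs : s ≤ 0) :
    u0 (A * c, B * s) = -(B * s) * ∫ t in (-1 : ℝ)..1, f (A * c, B * s * t) := by
  have : 1 - (A * c) ^ 2 / A ^ 2 = (-s) ^ 2 := by field_simp; linarith
  rw [hu0]
  simp only
  rw [this, sqrt_sq (by linarith), neg_mul,
    intervalIntegral.mul_integral_comp_mul_left (f := fun t => f (A * c, t)),
    intervalIntegral.integral_symm (B * s * 1)]
  simp

lemma contDiffOn_limitSolution (hf : ContDiff ℝ 1 f)
    (hu0 : ∀ p : ℝ × ℝ, u0 p = ∫ s in p.2..(B * √(1 - p.1 ^ 2 / A ^ 2)), f (p.1, s)) :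
    ContDiffOn ℝ 1 u0 {p : ℝ × ℝ | p.1 ^ 2 / A ^ 2 + p.2 ^ 2 / B ^ 2 < 1} := by
  rw [limitSolution_eq hf hu0]
  have hP := contDiff_one_primitive hf
  refine ContDiffOn.sub (hP.comp_contDiffOn ?_) hP.contDiffOn
  refine contDiffOn_fst.prodMk (contDiffOn_const.mul (ContDiffOn.sqrt (by fun_prop) ?_))
  intro p hp
  have hp' : p.1 ^ 2 / A ^ 2 + p.2 ^ 2 / B ^ 2 < 1 := hp
  have : 0 ≤ p.2 ^ 2 / B ^ 2 := by positivity
  exact ne_of_gt (by linarith)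

lemma isOpen_ellipse (A B : ℝ) : IsOpen {p : ℝ × ℝ | p.1 ^ 2 / A ^ 2 + p.2 ^ 2 / B ^ 2 < 1} :=
  isOpen_lt (by fun_prop) continuous_const

/-- The gradient of the limit solution is bounded when `f` vanishes at the characteristic points. -/
lemma fderiv_limitSolution (hA : 0 < A) (hB : 0 < B) (hf : ContDiff ℝ 1 f)
    (h1 : f (A, 0) = 0) (h2 : f (-A, 0) = 0)
    (hu0 : ∀ p : ℝ × ℝ, u0 p = ∫ s in p.2..(B * √(1 - p.1 ^ 2 / A ^ 2)), f (p.1, s)) :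
    ∃ C, ∀ p : ℝ × ℝ, p.1 ^ 2 / A ^ 2 + p.2 ^ 2 / B ^ 2 < 1 →
      |fderiv ℝ u0 p (1, 0)| ≤ C ∧ |fderiv ℝ u0 p (0, 1)| ≤ C ∧
      fderiv ℝ u0 p (0, 1) = -f p := by
  have hP := contDiff_one_primitive hf
  set P : ℝ × ℝ → ℝ := fun p : ℝ × ℝ => ∫ t in (0 : ℝ)..p.2, f (p.1, t) with hPdef
  have hPy : ∀ p, fderiv ℝ P p (0, 1) = f p := fun p => fderiv_primitive_snd hf p
  obtain ⟨K, hK⟩ := ((isCompact_Icc (a := -A) (b := A)).prod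
    (isCompact_Icc (a := -B) (b := B))).exists_bound_of_continuousOn
    (hP.continuous_fderiv one_ne_zero).continuousOn
  obtain ⟨K', hK'⟩ := ((isCompact_Icc (a := -A) (b := A)).prod
    (isCompact_Icc (a := -B) (b := B))).exists_bound_of_continuousOn hf.continuous.continuousOn
  obtain ⟨L, hL0, hL⟩ := exists_abs_le_of_eq_zero hf (B := B) h1 h2
  refine ⟨max (K + L * (A + B) * (B / A) + K) K', fun p hp => ?_⟩
  obtain ⟨hx, hy⟩ := abs_le_of_ellipse hA hB hp.le
  set r := √(1 - p.1 ^ 2 / A ^ 2) with hr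
  have hpos : 0 < 1 - p.1 ^ 2 / A ^ 2 := by
    have : 0 ≤ p.2 ^ 2 / B ^ 2 := by positivity
    linarith
  have hr0 : 0 < r := sqrt_pos.2 hpos
  have hr2 : r ^ 2 = 1 - p.1 ^ 2 / A ^ 2 := sq_sqrt hpos.le
  have hr1 : r ≤ 1 := by
    have : 0 ≤ p.1 ^ 2 / A ^ 2 := by positivity
    nlinarith
  have hxr : A - |p.1| ≤ A * r := by
    have e : A ^ 2 * r ^ 2 = A ^ 2 - |p.1| ^ 2 := by rw [hr2, sq_abs]; field_simp
    have h3 : A * (A - |p.1|) ≤ A * (A * r ^ 2) := by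
      nlinarith [mul_nonneg (sub_nonneg.2 hx) (abs_nonneg p.1)]
    have h4 := le_of_mul_le_mul_left h3 hA
    nlinarith
  have hCd : HasDerivAt (fun x : ℝ => B * √(1 - x ^ 2 / A ^ 2))
      (B * (-(2 * p.1 / A ^ 2) / (2 * r))) p.1 := by
    have := ((((hasDerivAt_id p.1).pow 2).div_const (A ^ 2)).const_sub 1).sqrt hpos.ne'
    refine (this.const_mul B).congr_deriv ?_
    simp [hr]
  have hfd : HasFDerivAt (fun p : ℝ × ℝ => (p.1, B * √(1 - p.1 ^ 2 / A ^ 2)))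
      ((ContinuousLinearMap.fst ℝ ℝ ℝ).prod
        ((B * (-(2 * p.1 / A ^ 2) / (2 * r))) • (ContinuousLinearMap.fst ℝ ℝ ℝ))) p :=
    hasFDerivAt_fst.prodMk (hCd.comp_hasFDerivAt p hasFDerivAt_fst)
  have hu := (((hP.differentiable one_ne_zero (p.1, B * r)).hasFDerivAt).comp p hfd).fun_sub
    (hP.differentiable one_ne_zero p).hasFDerivAt
  replace hu := hu.congr_of_eventuallyEq (Filter.EventuallyEq.of_eq (limitSolution_eq hf hu0))
  have hmem : (p.1, B * r) ∈ Icc (-A) A ×ˢ Icc (-B) B :=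
    ⟨abs_le.1 hx, by nlinarith, by nlinarith⟩
  have hmem' : p ∈ Icc (-A) A ×ˢ Icc (-B) B := ⟨abs_le.1 hx, abs_le.1 hy⟩
  have hPx : ∀ q ∈ Icc (-A) A ×ˢ Icc (-B) B, |fderiv ℝ P q (1, 0)| ≤ K := fun q hq => by
    have := (fderiv ℝ P q).le_of_opNorm_le (hK q hq) (1, 0)
    simpa using this
  have huy : fderiv ℝ u0 p (0, 1) = -f p := by
    rw [hu.fderiv]
    simp only [sub_apply, ContinuousLinearMap.comp_apply,
      ContinuousLinearMap.prod_apply, smul_apply,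
      ContinuousLinearMap.coe_fst', smul_eq_mul, mul_zero]
    rw [hPy, Prod.mk_zero_zero, map_zero, zero_sub]
  refine ⟨?_, ?_, huy⟩
  · refine le_trans ?_ (le_max_left _ _)
    rw [hu.fderiv]
    simp only [sub_apply, ContinuousLinearMap.comp_apply,
      ContinuousLinearMap.prod_apply, smul_apply,
      ContinuousLinearMap.coe_fst', smul_eq_mul, mul_one]
    set k := B * (-(2 * p.1 / A ^ 2) / (2 * r)) with hk
    have e : ((1 : ℝ), k) = (1, 0) + k • ((0 : ℝ), (1 : ℝ)) := by simp
    rw [e, map_add, map_smul, hPy, smul_eq_mul]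
    have hkb : |k * f (p.1, B * r)| ≤ L * (A + B) * (B / A) := by
      rw [abs_mul]
      have h5 := hL p.1 (B * r) hx (abs_le.2 hmem.2)
      rw [abs_of_nonneg (by positivity : 0 ≤ B * r)] at h5
      have h6 : |f (p.1, B * r)| ≤ L * ((A + B) * r) := h5.trans (by gcongr; linarith)
      have h7 : |k| ≤ B / (A * r) := by
        rw [hk, abs_mul, abs_of_pos hB, abs_div, abs_neg, abs_div, abs_mul,
          abs_of_pos (by positivity : 0 < A ^ 2), abs_of_pos (by positivity : 0 < 2 * r), abs_two]
        calc B * (2 * |p.1| / A ^ 2 / (2 * r)) ≤ B * (2 * A / A ^ 2 / (2 * r)) := by gcongr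
          _ = _ := by field_simp
      calc |k| * |f (p.1, B * r)| ≤ B / (A * r) * (L * ((A + B) * r)) := by gcongr
        _ = _ := by field_simp
    exact (abs_sub _ _).trans (add_le_add ((abs_add_le _ _).trans
      (add_le_add (hPx _ hmem) hkb)) (hPx _ hmem'))
  · rw [huy, abs_neg]
    exact (hK' p hmem').trans (le_max_right _ _)

end LimitSolution

/-- Extension by zero from the lower half plane. -/
noncomputable def lowerExt (G : ℝ × ℝ → ℝ) (p : ℝ × ℝ) : ℝ := if p.2 < 0 then G p else 0

lemma lowerExt_of_neg {G : ℝ × ℝ → ℝ} {p : ℝ × ℝ} (hp : p.2 < 0) : lowerExt G p = G p :=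
  if_pos hp

lemma lowerExt_of_nonneg {G : ℝ × ℝ → ℝ} {p : ℝ × ℝ} (hp : 0 ≤ p.2) : lowerExt G p = 0 :=
  if_neg hp.not_gt

lemma lowerExt_eventuallyEq {G : ℝ × ℝ → ℝ} {p : ℝ × ℝ} (hp : p.2 < 0) :
    lowerExt G =ᶠ[𝓝 p] G := by
  filter_upwards [(isOpen_lt continuous_snd continuous_const).mem_nhds hp] with q hq
  exact lowerExt_of_neg hq

lemma lowerExt_eventuallyEq_zero {G : ℝ × ℝ → ℝ} {p : ℝ × ℝ} (hp : 0 < p.2) :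
    lowerExt G =ᶠ[𝓝 p] fun _ => 0 := by
  filter_upwards [(isOpen_lt continuous_const continuous_snd).mem_nhds hp] with q hq
  exact lowerExt_of_nonneg (le_of_lt hq)

lemma abs_lowerExt_le {G : ℝ × ℝ → ℝ} {C : ℝ} (hC : 0 ≤ C) {p : ℝ × ℝ}
    (h : p.2 < 0 → |G p| ≤ C * p.2 ^ 2) : |lowerExt G p| ≤ C * p.2 ^ 2 := by
  by_cases hp : p.2 < 0
  · rw [lowerExt_of_neg hp]; exact h hp
  · rw [lowerExt_of_nonneg (not_lt.1 hp), abs_zero]; positivity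

/-- A function vanishing to second order on the line `y = 0` can be extended by zero across it. -/
lemma contDiffOn_lowerExt {Ω : Set (ℝ × ℝ)} (hΩ : IsOpen Ω) {G : ℝ × ℝ → ℝ} {C : ℝ} (hC : 0 ≤ C)
    (hG : ∀ p ∈ Ω, p.2 < 0 → ContDiffAt ℝ 1 G p)
    (h0 : ∀ p ∈ Ω, p.2 < 0 → |G p| ≤ C * p.2 ^ 2)
    (h1 : ∀ p ∈ Ω, p.2 < 0 → ‖fderiv ℝ G p‖ ≤ C * |p.2|) :
    ContDiffOn ℝ 1 (lowerExt G) Ω ∧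
      (∀ p ∈ Ω, 0 ≤ p.2 → fderiv ℝ (lowerExt G) p = 0) ∧
      ∀ p ∈ Ω, p.2 < 0 → fderiv ℝ (lowerExt G) p = fderiv ℝ G p := by
  have hneg : ∀ p ∈ Ω, p.2 < 0 → fderiv ℝ (lowerExt G) p = fderiv ℝ G p := fun p _ hy =>
    (lowerExt_eventuallyEq hy).fderiv_eq
  have hzero : ∀ p ∈ Ω, p.2 = 0 → HasFDerivAt (lowerExt G) (0 : ℝ × ℝ →L[ℝ] ℝ) p := by
    intro p hp hy
    refine Asymptotics.IsBigO.hasFDerivAt (n := 2) ?_ one_lt_two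
    refine Asymptotics.IsBigO.of_bound C ?_
    filter_upwards [hΩ.mem_nhds hp] with q hq
    rw [norm_eq_abs, norm_pow, norm_norm]
    refine (abs_lowerExt_le hC (h0 q hq)).trans (mul_le_mul_of_nonneg_left ?_ hC)
    rw [← sq_abs]
    gcongr
    have : |q.2 - p.2| ≤ ‖q - p‖ := norm_snd_le (q - p)
    rwa [hy, sub_zero] at this
  have hpos : ∀ p ∈ Ω, 0 ≤ p.2 → HasFDerivAt (lowerExt G) (0 : ℝ × ℝ →L[ℝ] ℝ) p := by
    intro p hp hy
    rcases hy.eq_or_lt with h | h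
    · exact hzero p hp h.symm
    · exact (hasFDerivAt_const (0 : ℝ) p).congr_of_eventuallyEq (lowerExt_eventuallyEq_zero h)
  refine ⟨fun p hp => ContDiffAt.contDiffWithinAt ?_, fun p hp hy => (hpos p hp hy).fderiv, hneg⟩
  rcases lt_trichotomy p.2 0 with hy | hy | hy
  · exact (hG p hp hy).congr_of_eventuallyEq (lowerExt_eventuallyEq hy)
  · have hdiff : DifferentiableOn ℝ (lowerExt G) Ω := by
      intro q hq
      by_cases hqy : q.2 < 0
      · exact (((hG q hq hqy).differentiableAt one_ne_zero).congr_of_eventuallyEq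
          (lowerExt_eventuallyEq hqy)).differentiableWithinAt
      · exact (hpos q hq (not_lt.1 hqy)).differentiableAt.differentiableWithinAt
    have hb : ∀ q ∈ Ω, ‖fderiv ℝ (lowerExt G) q‖ ≤ C * |q.2| := by
      intro q hq
      by_cases hqy : q.2 < 0
      · rw [hneg q hq hqy]; exact h1 q hq hqy
      · rw [(hpos q hq (not_lt.1 hqy)).fderiv, norm_zero]; positivity
    have hcont : ContinuousOn (fderiv ℝ (lowerExt G)) Ω := by
      intro q hq
      refine ContinuousAt.continuousWithinAt ?_
      rcases lt_or_ge q.2 0 with hqy | hqy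
      · have h2 : ContinuousAt (fderiv ℝ G) q :=
          ((hG q hq hqy).fderiv_right (m := 0) le_rfl).continuousAt
        exact h2.congr ((lowerExt_eventuallyEq hqy).fderiv).symm
      · rcases hqy.eq_or_lt with h | h
        · rw [ContinuousAt, (hpos q hq hqy).fderiv, tendsto_zero_iff_norm_tendsto_zero]
          have : Filter.Tendsto (fun r : ℝ × ℝ => C * |r.2|) (𝓝 q) (𝓝 0) := by
            have hc : Continuous fun r : ℝ × ℝ => C * |r.2| := by fun_prop
            have := hc.tendsto q
            rwa [← h, abs_zero, mul_zero] at this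
          exact squeeze_zero' (Filter.Eventually.of_forall fun _ => norm_nonneg _)
            (by filter_upwards [hΩ.mem_nhds hq] with r hr using hb r hr) this
        · have := (lowerExt_eventuallyEq_zero (G := G) h).fderiv (𝕜 := ℝ)
          refine ContinuousAt.congr ?_ this.symm
          simp only [fderiv_fun_const]
          exact continuousAt_const
    have : ContDiffOn ℝ (0 + 1) (lowerExt G) Ω :=
      (contDiffOn_succ_iff_fderiv_of_isOpen hΩ).2 ⟨hdiff, by simp, contDiffOn_zero.2 hcont⟩
    rw [zero_add] at this
    exact this.contDiffAt (hΩ.mem_nhds hp)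
  · exact (contDiffAt_const (c := (0 : ℝ))).congr_of_eventuallyEq (lowerExt_eventuallyEq_zero hy)

lemma partialX_eq_fderiv {w : ℝ × ℝ → ℝ} {p : ℝ × ℝ} (h : DifferentiableAt ℝ w p) :
    partialX w p = fderiv ℝ w p (1, 0) := by
  have h2 : HasDerivAt (fun x : ℝ => (x, p.2)) ((1 : ℝ), (0 : ℝ)) p.1 :=
    (hasDerivAt_id _).prodMk (hasDerivAt_const _ _)
  exact (h.hasFDerivAt.comp_hasDerivAt p.1 h2).deriv

lemma partialY_eq_fderiv {w : ℝ × ℝ → ℝ} {p : ℝ × ℝ} (h : DifferentiableAt ℝ w p) :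
    partialY w p = fderiv ℝ w p (0, 1) := by
  have h2 : HasDerivAt (fun y : ℝ => (p.1, y)) ((0 : ℝ), (1 : ℝ)) p.2 :=
    (hasDerivAt_const _ _).prodMk (hasDerivAt_id _)
  exact (h.hasFDerivAt.comp_hasDerivAt p.2 h2).deriv

lemma partialX_congr {w v : ℝ × ℝ → ℝ} {p : ℝ × ℝ} (h : w =ᶠ[𝓝 p] v) :
    partialX w p = partialX v p := by
  have hc : Filter.Tendsto (fun x : ℝ => (x, p.2)) (𝓝 p.1) (𝓝 p) :=
    (by fun_prop : Continuous fun x : ℝ => (x, p.2)).tendsto p.1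
  exact Filter.EventuallyEq.deriv_eq (hc.eventually h)

lemma partialY_congr {w v : ℝ × ℝ → ℝ} {p : ℝ × ℝ} (h : w =ᶠ[𝓝 p] v) :
    partialY w p = partialY v p := by
  have hc : Filter.Tendsto (fun y : ℝ => (p.1, y)) (𝓝 p.2) (𝓝 p) :=
    (by fun_prop : Continuous fun y : ℝ => (p.1, y)).tendsto p.2
  exact Filter.EventuallyEq.deriv_eq (hc.eventually h)

lemma contDiffOn_fderiv_apply {Ω : Set (ℝ × ℝ)} (hΩ : IsOpen Ω) {u : ℝ × ℝ → ℝ}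
    (hu : ContDiffOn ℝ 2 u Ω) (v : ℝ × ℝ) : ContDiffOn ℝ 1 (fun p => fderiv ℝ u p v) Ω :=
  (hu.fderiv_of_isOpen hΩ (m := 1) (by norm_num)).clm_apply contDiffOn_const

lemma partialX_partialX_eq {Ω : Set (ℝ × ℝ)} (hΩ : IsOpen Ω) {u : ℝ × ℝ → ℝ}
    (hu : ContDiffOn ℝ 2 u Ω) {p : ℝ × ℝ} (hp : p ∈ Ω) :
    partialX (partialX u) p = fderiv ℝ (fun q => fderiv ℝ u q (1, 0)) p (1, 0) := by
  have h1 : partialX u =ᶠ[𝓝 p] fun q => fderiv ℝ u q (1, 0) := by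
    filter_upwards [hΩ.mem_nhds hp] with q hq
    exact partialX_eq_fderiv ((hu.contDiffAt (hΩ.mem_nhds hq)).differentiableAt two_ne_zero)
  rw [partialX_congr h1, partialX_eq_fderiv]
  exact ((contDiffOn_fderiv_apply hΩ hu _).contDiffAt (hΩ.mem_nhds hp)).differentiableAt one_ne_zero

lemma partialY_partialY_eq {Ω : Set (ℝ × ℝ)} (hΩ : IsOpen Ω) {u : ℝ × ℝ → ℝ}
    (hu : ContDiffOn ℝ 2 u Ω) {p : ℝ × ℝ} (hp : p ∈ Ω) :
    partialY (partialY u) p = fderiv ℝ (fun q => fderiv ℝ u q (0, 1)) p (0, 1) := by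
  have h1 : partialY u =ᶠ[𝓝 p] fun q => fderiv ℝ u q (0, 1) := by
    filter_upwards [hΩ.mem_nhds hp] with q hq
    exact partialY_eq_fderiv ((hu.contDiffAt (hΩ.mem_nhds hq)).differentiableAt two_ne_zero)
  rw [partialY_congr h1, partialY_eq_fderiv]
  exact ((contDiffOn_fderiv_apply hΩ hu _).contDiffAt (hΩ.mem_nhds hp)).differentiableAt one_ne_zero

/-- Pointwise bound on the residual of the corrector. -/
lemma residual_sq_le {ε C B θ θx θy S Sx Sy Λ y q : ℝ} (hε : 0 < ε) (hC : 0 ≤ C)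
    (hyB : |y| ≤ B) (hS : S ≤ y * q / 2) (hS0 : S ≤ 0) (hθ : |θ| ≤ C * y ^ 2)
    (hθx : |θx| ≤ C * |y|) (hθy : |θy| ≤ C * |y|) (hSx : |Sx| ≤ C) (hSy : |Sy| ≤ C)
    (hΛ : |Λ| ≤ C) (hSS : |y| * |Sx ^ 2 + Sy ^ 2 + Sy| ≤ C * |S|) :
    (θ * exp (S / ε) / ε * (Sx ^ 2 + Sy ^ 2 + Sy) + exp (S / ε) * (θx * Sx + θy * (Sy + 1)) +
      θ * exp (S / ε) * Λ) ^ 2 ≤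
      (3 * C ^ 2 + C + C ^ 2 * B) ^ 2 * (y ^ 2 * exp (y * q / (2 * ε))) := by
  have hB : 0 ≤ B := (abs_nonneg y).trans hyB
  set e := exp (S / (2 * ε)) with he
  have hee : exp (S / ε) = e * e := by rw [he, ← exp_add]; congr 1; field_simp; norm_num
  have he0 : 0 < e := exp_pos _
  have he1 : e ≤ 1 := exp_le_one_iff.2 (div_nonpos_of_nonpos_of_nonneg hS0 (by positivity))
  have het : |S| / ε * e ≤ 1 := by
    have h1 := quadratic_le_exp_of_nonneg (x := |S| / (2 * ε)) (by positivity)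
    have h2 : e * exp (|S| / (2 * ε)) = 1 := by
      rw [he, ← exp_add, abs_of_nonpos hS0, ← add_div, add_neg_cancel, zero_div, exp_zero]
    have h3 : |S| / ε = 2 * (|S| / (2 * ε)) := by field_simp
    rw [h3]
    set t := |S| / (2 * ε)
    rw [← h2, mul_comm]
    exact mul_le_mul_of_nonneg_left (by nlinarith [sq_nonneg (t - 1)]) he0.le
  have hy2 : y ^ 2 = |y| * |y| := by rw [← sq_abs, sq]
  have hA1 : |θ * exp (S / ε) / ε * (Sx ^ 2 + Sy ^ 2 + Sy)| ≤ C ^ 2 * |y| * e := by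
    rw [abs_mul, abs_div, abs_mul, abs_exp, abs_of_pos hε, hee]
    set Z := |Sx ^ 2 + Sy ^ 2 + Sy|
    calc |θ| * (e * e) / ε * Z ≤ (C * y ^ 2) * (e * e) / ε * Z := by gcongr
      _ = C * |y| * (e * e) / ε * (|y| * Z) := by rw [hy2]; ring
      _ ≤ C * |y| * (e * e) / ε * (C * |S|) := by gcongr
      _ = C ^ 2 * |y| * e * (|S| / ε * e) := by ring
      _ ≤ C ^ 2 * |y| * e * 1 := by gcongr
      _ = _ := mul_one _
  have hA2 : |exp (S / ε) * (θx * Sx + θy * (Sy + 1))| ≤ (2 * C ^ 2 + C) * |y| * e := by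
    rw [abs_mul, abs_exp, hee]
    have h1 : |θx * Sx + θy * (Sy + 1)| ≤ (2 * C ^ 2 + C) * |y| := by
      calc |θx * Sx + θy * (Sy + 1)| ≤ |θx| * |Sx| + |θy| * |Sy + 1| := by
            rw [← abs_mul, ← abs_mul]; exact abs_add_le _ _
        _ ≤ (C * |y|) * C + (C * |y|) * (C + 1) := by
            gcongr
            exact (abs_add_le _ _).trans (by rw [abs_one]; linarith)
        _ = _ := by ring
    calc e * e * |θx * Sx + θy * (Sy + 1)| ≤ e * 1 * ((2 * C ^ 2 + C) * |y|) := by gcongr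
      _ = _ := by ring
  have hA3 : |θ * exp (S / ε) * Λ| ≤ C ^ 2 * B * |y| * e := by
    rw [abs_mul, abs_mul, abs_exp, hee]
    calc |θ| * (e * e) * |Λ| ≤ (C * y ^ 2) * (e * 1) * C := by gcongr
      _ = C ^ 2 * |y| * |y| * e := by rw [hy2]; ring
      _ ≤ C ^ 2 * B * |y| * e := by gcongr
  have hsum : |θ * exp (S / ε) / ε * (Sx ^ 2 + Sy ^ 2 + Sy) +
      exp (S / ε) * (θx * Sx + θy * (Sy + 1)) + θ * exp (S / ε) * Λ| ≤
      (3 * C ^ 2 + C + C ^ 2 * B) * |y| * e := by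
    refine (abs_add_le _ _).trans ((add_le_add (abs_add_le _ _) le_rfl).trans ?_)
    linarith
  have hexp : e * e ≤ exp (y * q / (2 * ε)) := by
    rw [← hee]
    refine exp_le_exp.2 ?_
    rw [div_le_div_iff₀ hε (by positivity)]
    nlinarith
  rw [← sq_abs]
  calc _ ≤ ((3 * C ^ 2 + C + C ^ 2 * B) * |y| * e) ^ 2 := by gcongr
    _ = (3 * C ^ 2 + C + C ^ 2 * B) ^ 2 * (y ^ 2 * (e * e)) := by rw [hy2]; ring
    _ ≤ _ := by gcongr

/-- Properties of an amplitude `θ` and a phase `S` on the lower half of the ellipse under which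
`θ * exp (S / ε)` is a corrector for the limit solution `u0`. -/
structure IsLayerData (A B C : ℝ) (u0 θ S : ℝ × ℝ → ℝ) : Prop where
  nonneg : 0 ≤ C
  contDiffAt_amp : ∀ p : ℝ × ℝ, p.1 ^ 2 / A ^ 2 + p.2 ^ 2 / B ^ 2 ≤ 1 → p.2 < 0 →
    ContDiffAt ℝ 1 θ p
  contDiffAt_phase : ∀ p : ℝ × ℝ, p.1 ^ 2 / A ^ 2 + p.2 ^ 2 / B ^ 2 ≤ 1 → p.2 < 0 →
    ContDiffAt ℝ 2 S p
  abs_amp_le : ∀ p : ℝ × ℝ, p.1 ^ 2 / A ^ 2 + p.2 ^ 2 / B ^ 2 ≤ 1 → p.2 < 0 →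
    |θ p| ≤ C * p.2 ^ 2
  norm_fderiv_amp_le : ∀ p : ℝ × ℝ, p.1 ^ 2 / A ^ 2 + p.2 ^ 2 / B ^ 2 ≤ 1 → p.2 < 0 →
    ‖fderiv ℝ θ p‖ ≤ C * |p.2|
  phase_le : ∀ p : ℝ × ℝ, p.1 ^ 2 / A ^ 2 + p.2 ^ 2 / B ^ 2 ≤ 1 → p.2 < 0 →
    S p ≤ p.2 * (1 - p.1 ^ 2 / A ^ 2 - p.2 ^ 2 / B ^ 2) / 2
  near : ∀ p : ℝ × ℝ, p.1 ^ 2 / A ^ 2 + p.2 ^ 2 / B ^ 2 ≤ 1 → p.2 < 0 →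
    θ =ᶠ[𝓝 p] 0 ∨ (‖fderiv ℝ S p‖ ≤ C ∧ ‖fderiv ℝ (fun q => fderiv ℝ S q (1, 0)) p‖ ≤ C ∧
      ‖fderiv ℝ (fun q => fderiv ℝ S q (0, 1)) p‖ ≤ C ∧
      |p.2| * |fderiv ℝ S p (1, 0) ^ 2 + fderiv ℝ S p (0, 1) ^ 2 + fderiv ℝ S p (0, 1)| ≤
        C * |S p|)
  boundary : ∀ p : ℝ × ℝ, p.1 ^ 2 / A ^ 2 + p.2 ^ 2 / B ^ 2 = 1 → p.2 < 0 →
    S p = 0 ∧ θ p = -u0 p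

lemma abs_apply_le_of_norm_le {T : ℝ × ℝ →L[ℝ] ℝ} {C : ℝ} (h : ‖T‖ ≤ C) {v : ℝ × ℝ}
    (hv : ‖v‖ = 1) : |T v| ≤ C := by
  have := T.le_of_opNorm_le h v
  rwa [hv, mul_one] at this

namespace IsLayerData

variable {A B C : ℝ} {u0 θ S : ℝ × ℝ → ℝ}

lemma phase_nonpos (h : IsLayerData A B C u0 θ S) {p : ℝ × ℝ}
    (hp : p.1 ^ 2 / A ^ 2 + p.2 ^ 2 / B ^ 2 ≤ 1) (hy : p.2 < 0) : S p ≤ 0 := by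
  refine (h.phase_le p hp hy).trans ?_
  nlinarith

lemma exp_le_one (h : IsLayerData A B C u0 θ S) {ε : ℝ} (hε : 0 < ε) {p : ℝ × ℝ}
    (hp : p.1 ^ 2 / A ^ 2 + p.2 ^ 2 / B ^ 2 ≤ 1) (hy : p.2 < 0) : exp (S p / ε) ≤ 1 :=
  exp_le_one_iff.2 (div_nonpos_of_nonpos_of_nonneg (h.phase_nonpos hp hy) hε.le)

/-- Products of the amplitude with functions that are `C¹` on its support extend by zero. -/
lemma contDiffOn_lowerExt_mul (h : IsLayerData A B C u0 θ S) (hA : 0 < A) (hB : 0 < B)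
    {F : ℝ × ℝ → ℝ} {K : ℝ} (hK : 0 ≤ K)
    (hF : ∀ p : ℝ × ℝ, p.1 ^ 2 / A ^ 2 + p.2 ^ 2 / B ^ 2 ≤ 1 → p.2 < 0 → ContDiffAt ℝ 1 F p)
    (hb : ∀ p : ℝ × ℝ, p.1 ^ 2 / A ^ 2 + p.2 ^ 2 / B ^ 2 ≤ 1 → p.2 < 0 →
      θ =ᶠ[𝓝 p] 0 ∨ (|F p| ≤ K ∧ ‖fderiv ℝ F p‖ ≤ K)) :
    ContDiffOn ℝ 1 (lowerExt fun p => θ p * F p)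
        {p : ℝ × ℝ | p.1 ^ 2 / A ^ 2 + p.2 ^ 2 / B ^ 2 < 1} ∧
      (∀ p : ℝ × ℝ, p.1 ^ 2 / A ^ 2 + p.2 ^ 2 / B ^ 2 < 1 → 0 ≤ p.2 →
        fderiv ℝ (lowerExt fun p => θ p * F p) p = 0) ∧
      ∀ p : ℝ × ℝ, p.1 ^ 2 / A ^ 2 + p.2 ^ 2 / B ^ 2 < 1 → p.2 < 0 → ∀ v,
        fderiv ℝ (lowerExt fun p => θ p * F p) p v =
          θ p * fderiv ℝ F p v + F p * fderiv ℝ θ p v := by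
  have hC := h.nonneg
  have hfd : ∀ p : ℝ × ℝ, p.1 ^ 2 / A ^ 2 + p.2 ^ 2 / B ^ 2 ≤ 1 → p.2 < 0 →
      fderiv ℝ (fun p => θ p * F p) p = θ p • fderiv ℝ F p + F p • fderiv ℝ θ p :=
    fun p hp hy => fderiv_fun_mul ((h.contDiffAt_amp p hp hy).differentiableAt one_ne_zero)
      ((hF p hp hy).differentiableAt one_ne_zero)
  obtain ⟨h1, h2, h3⟩ := contDiffOn_lowerExt (isOpen_ellipse A B) (G := fun p => θ p * F p)
    (C := C * K * (B + 1)) (by positivity)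
    (fun p hp hy => (h.contDiffAt_amp p (le_of_lt hp) hy).mul (hF p (le_of_lt hp) hy))
    (fun p hp hy => by
      have hp' : p.1 ^ 2 / A ^ 2 + p.2 ^ 2 / B ^ 2 ≤ 1 := le_of_lt hp
      rcases hb p hp' hy with hz | ⟨hb1, -⟩
      · simp only [hz.eq_of_nhds, Pi.zero_apply, zero_mul, abs_zero]
        positivity
      · rw [abs_mul]
        calc |θ p| * |F p| ≤ (C * p.2 ^ 2) * K := by
              gcongr; exact h.abs_amp_le p hp' hy
          _ ≤ (C * p.2 ^ 2) * K + C * p.2 ^ 2 * K * B := le_add_of_nonneg_right (by positivity)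
          _ = _ := by ring)
    (fun p hp hy => by
      have hp' : p.1 ^ 2 / A ^ 2 + p.2 ^ 2 / B ^ 2 ≤ 1 := le_of_lt hp
      rw [hfd p hp' hy]
      rcases hb p hp' hy with hz | ⟨hb1, hb2⟩
      · simp only [hz.eq_of_nhds, hz.fderiv_eq, Pi.zero_apply, zero_smul, fderiv_zero,
          smul_zero, add_zero, norm_zero]
        positivity
      · have hyB := (abs_le_of_ellipse hA hB hp').2
        refine (norm_add_le _ _).trans ?_
        rw [norm_smul, norm_smul, norm_eq_abs, norm_eq_abs]
        calc |θ p| * ‖fderiv ℝ F p‖ + |F p| * ‖fderiv ℝ θ p‖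
            ≤ (C * p.2 ^ 2) * K + K * (C * |p.2|) := by
              gcongr
              · exact h.abs_amp_le p hp' hy
              · exact h.norm_fderiv_amp_le p hp' hy
          _ = C * K * (|p.2| + 1) * |p.2| := by rw [← sq_abs]; ring
          _ ≤ _ := by gcongr)
  refine ⟨h1, h2, fun p hp hy v => ?_⟩
  rw [h3 p hp hy, hfd p hp.le hy]
  rfl

/-- The corrector is continuous up to the boundary. -/
lemma continuousOn_corrector (h : IsLayerData A B C u0 θ S) {ε : ℝ} (hε : 0 < ε) :
    ContinuousOn (lowerExt fun p => θ p * exp (S p / ε))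
      {p : ℝ × ℝ | p.1 ^ 2 / A ^ 2 + p.2 ^ 2 / B ^ 2 ≤ 1} := by
  intro p hp
  have hp' : p.1 ^ 2 / A ^ 2 + p.2 ^ 2 / B ^ 2 ≤ 1 := hp
  rcases lt_trichotomy p.2 0 with hy | hy | hy
  · refine ContinuousAt.continuousWithinAt (ContinuousAt.congr ?_ (lowerExt_eventuallyEq hy).symm)
    exact (h.contDiffAt_amp p hp hy).continuousAt.mul
      ((h.contDiffAt_phase p hp hy).continuousAt.div_const _).rexp
  · rw [ContinuousWithinAt, lowerExt_of_nonneg hy.ge, tendsto_zero_iff_norm_tendsto_zero]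
    have ht : Filter.Tendsto (fun r : ℝ × ℝ => C * r.2 ^ 2)
        (𝓝[{p : ℝ × ℝ | p.1 ^ 2 / A ^ 2 + p.2 ^ 2 / B ^ 2 ≤ 1}] p) (𝓝 0) := by
      have hc : Continuous fun r : ℝ × ℝ => C * r.2 ^ 2 := by fun_prop
      have := (hc.tendsto p).mono_left
        (nhdsWithin_le_nhds (s := {p : ℝ × ℝ | p.1 ^ 2 / A ^ 2 + p.2 ^ 2 / B ^ 2 ≤ 1}))
      simpa [hy] using this
    refine squeeze_zero' (Filter.Eventually.of_forall fun _ => norm_nonneg _) ?_ ht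
    filter_upwards [self_mem_nhdsWithin] with q hq
    refine abs_lowerExt_le h.nonneg fun hqy => ?_
    rw [abs_mul, abs_exp]
    exact (mul_le_of_le_one_right (abs_nonneg _) (h.exp_le_one hε hq hqy)).trans
      (h.abs_amp_le q hq hqy)
  · exact ContinuousAt.continuousWithinAt
      (continuousAt_const.congr (lowerExt_eventuallyEq_zero hy).symm)

end IsLayerData

lemma isCompact_closedEllipse {A B : ℝ} (hA : 0 < A) (hB : 0 < B) :
    IsCompact {p : ℝ × ℝ | p.1 ^ 2 / A ^ 2 + p.2 ^ 2 / B ^ 2 ≤ 1} := by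
  refine ((isCompact_Icc (a := -A) (b := A)).prod (isCompact_Icc (a := -B) (b := B))
    ).of_isClosed_subset (isClosed_le (by fun_prop) continuous_const) fun p hp => ?_
  obtain ⟨h1, h2⟩ := abs_le_of_ellipse hA hB hp
  exact ⟨abs_le.1 h1, abs_le.1 h2⟩

/-- Energy estimate for the remainder of the first-order boundary-layer expansion. -/
lemma exists_lintegral_remainder_le {A B C C₀ : ℝ} (hA : 0 < A) (hB : 0 < B)
    {f u0 θ S : ℝ × ℝ → ℝ} (h : IsLayerData A B C u0 θ S) (hu0c : Continuous u0)
    (hu0d : ContDiffOn ℝ 1 u0 {p : ℝ × ℝ | p.1 ^ 2 / A ^ 2 + p.2 ^ 2 / B ^ 2 < 1})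
    (hu0b : ∀ p : ℝ × ℝ, p.1 ^ 2 / A ^ 2 + p.2 ^ 2 / B ^ 2 < 1 →
      |fderiv ℝ u0 p (1, 0)| ≤ C₀ ∧ |fderiv ℝ u0 p (0, 1)| ≤ C₀ ∧
      fderiv ℝ u0 p (0, 1) = -f p)
    (hu0z : ∀ p : ℝ × ℝ, p.1 ^ 2 / A ^ 2 + p.2 ^ 2 / B ^ 2 = 1 → 0 ≤ p.2 → u0 p = 0) :
    ∃ K, 0 ≤ K ∧ ∀ ε ∈ Ioc (0 : ℝ) 1, ∀ u : ℝ × ℝ → ℝ,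
      ContDiffOn ℝ 2 u {p : ℝ × ℝ | p.1 ^ 2 / A ^ 2 + p.2 ^ 2 / B ^ 2 < 1} →
      ContinuousOn u {p : ℝ × ℝ | p.1 ^ 2 / A ^ 2 + p.2 ^ 2 / B ^ 2 ≤ 1} →
      (∀ p : ℝ × ℝ, p.1 ^ 2 / A ^ 2 + p.2 ^ 2 / B ^ 2 < 1 →
        -ε * (partialX (partialX u) p + partialY (partialY u) p) - partialY u p = f p) →
      (∀ p : ℝ × ℝ, p.1 ^ 2 / A ^ 2 + p.2 ^ 2 / B ^ 2 = 1 → u p = 0) →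
      ∀ w : ℝ × ℝ → ℝ, (w = fun p => u p - u0 p - lowerExt (fun q => θ q * exp (S q / ε)) p) →
      ContDiffOn ℝ 1 w {p : ℝ × ℝ | p.1 ^ 2 / A ^ 2 + p.2 ^ 2 / B ^ 2 < 1} ∧
      ∫⁻ p in {p : ℝ × ℝ | p.1 ^ 2 / A ^ 2 + p.2 ^ 2 / B ^ 2 < 1}, ENNReal.ofReal (ε / 2 *
        (fderiv ℝ w p (1, 0) ^ 2 + fderiv ℝ w p (0, 1) ^ 2) + w p ^ 2 / 16) ≤
      ENNReal.ofReal (K * ε) := by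
  have hC := h.nonneg
  set Ω : Set (ℝ × ℝ) := {p : ℝ × ℝ | p.1 ^ 2 / A ^ 2 + p.2 ^ 2 / B ^ 2 < 1} with hΩdef
  have hΩ : IsOpen Ω := isOpen_ellipse A B
  set C₃ := (3 * (2 * C) ^ 2 + 2 * C + (2 * C) ^ 2 * B) ^ 2 with hC₃
  refine ⟨exp B * (3 * (C₀ + C * B) ^ 2 * volume.real Ω + 8 * (C₃ * (8 * A * B ^ 2))),
    by positivity, ?_⟩
  rintro ε ⟨hε, hε1⟩ u hu huc hpde hub w rfl
  have hexpd : ∀ p : ℝ × ℝ, p.1 ^ 2 / A ^ 2 + p.2 ^ 2 / B ^ 2 ≤ 1 → p.2 < 0 →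
      HasFDerivAt (fun q => exp (S q / ε)) ((exp (S p / ε) / ε) • fderiv ℝ S p) p := by
    intro p hp hy
    have h1 := ((h.contDiffAt_phase p hp hy).differentiableAt two_ne_zero).hasFDerivAt
    have h2 : HasDerivAt (fun t : ℝ => exp (t / ε)) (exp (S p / ε) / ε) (S p) := by
      have := ((hasDerivAt_id (S p)).div_const ε).exp
      simpa [div_eq_mul_inv] using this
    exact h2.comp_hasFDerivAt p h1
  have hexpc : ∀ p : ℝ × ℝ, p.1 ^ 2 / A ^ 2 + p.2 ^ 2 / B ^ 2 ≤ 1 → p.2 < 0 →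
      ContDiffAt ℝ 1 (fun q => exp (S q / ε)) p := fun p hp hy =>
    (((h.contDiffAt_phase p hp hy).of_le (by norm_num)).div_const ε).exp
  have hnexp : ∀ p : ℝ × ℝ, p.1 ^ 2 / A ^ 2 + p.2 ^ 2 / B ^ 2 ≤ 1 → p.2 < 0 →
      ‖fderiv ℝ S p‖ ≤ C → ‖fderiv ℝ (fun q => exp (S q / ε)) p‖ ≤ C / ε := by
    intro p hp hy hS
    rw [(hexpd p hp hy).fderiv, norm_smul, norm_eq_abs, abs_div, abs_exp, abs_of_pos hε]
    calc exp (S p / ε) / ε * ‖fderiv ℝ S p‖ ≤ 1 / ε * C := by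
          gcongr; exact h.exp_le_one hε hp hy
      _ = C / ε := by ring
  obtain ⟨hφ1, hφ2, hφ3⟩ := h.contDiffOn_lowerExt_mul hA hB (F := fun q => exp (S q / ε))
    (K := 1 + C / ε) (by positivity) hexpc fun p hp hy => by
      refine (h.near p hp hy).imp_right fun hn => ⟨?_, ?_⟩
      · rw [abs_exp]
        exact (h.exp_le_one hε hp hy).trans (le_add_of_nonneg_right (by positivity))
      · exact (hnexp p hp hy hn.1).trans (le_add_of_nonneg_left zero_le_one)
  have hJ : ∀ v : ℝ × ℝ, ‖v‖ = 1 →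
      (∀ p : ℝ × ℝ, p.1 ^ 2 / A ^ 2 + p.2 ^ 2 / B ^ 2 ≤ 1 → p.2 < 0 → θ =ᶠ[𝓝 p] 0 ∨
        (‖fderiv ℝ S p‖ ≤ C ∧ ‖fderiv ℝ (fun q => fderiv ℝ S q v) p‖ ≤ C)) →
      ContDiffOn ℝ 1 (lowerExt fun p => θ p * (exp (S p / ε) * fderiv ℝ S p v)) Ω ∧
      (∀ p : ℝ × ℝ, p ∈ Ω → 0 ≤ p.2 →
        fderiv ℝ (lowerExt fun p => θ p * (exp (S p / ε) * fderiv ℝ S p v)) p = 0) ∧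
      ∀ p : ℝ × ℝ, p ∈ Ω → p.2 < 0 →
        fderiv ℝ (lowerExt fun p => θ p * (exp (S p / ε) * fderiv ℝ S p v)) p v =
          θ p * exp (S p / ε) / ε * fderiv ℝ S p v ^ 2 +
          exp (S p / ε) * (fderiv ℝ θ p v * fderiv ℝ S p v) +
          θ p * exp (S p / ε) * fderiv ℝ (fun q => fderiv ℝ S q v) p v := by
    intro v hv hn
    have hSv : ∀ p : ℝ × ℝ, p.1 ^ 2 / A ^ 2 + p.2 ^ 2 / B ^ 2 ≤ 1 → p.2 < 0 →
        ContDiffAt ℝ 1 (fun q => fderiv ℝ S q v) p := fun p hp hy =>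
      ((h.contDiffAt_phase p hp hy).fderiv_right (m := 1) (by norm_num)).clm_apply contDiffAt_const
    have hfd : ∀ p : ℝ × ℝ, p.1 ^ 2 / A ^ 2 + p.2 ^ 2 / B ^ 2 ≤ 1 → p.2 < 0 →
        fderiv ℝ (fun q => exp (S q / ε) * fderiv ℝ S q v) p =
        exp (S p / ε) • fderiv ℝ (fun q => fderiv ℝ S q v) p +
          fderiv ℝ S p v • fderiv ℝ (fun q => exp (S q / ε)) p := fun p hp hy =>
      fderiv_fun_mul (hexpd p hp hy).differentiableAt
        ((hSv p hp hy).differentiableAt one_ne_zero)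
    obtain ⟨h1, h2, h3⟩ := h.contDiffOn_lowerExt_mul hA hB
      (F := fun q => exp (S q / ε) * fderiv ℝ S q v)
      (K := C + C * (C / ε)) (by positivity) (fun p hp hy => (hexpc p hp hy).mul (hSv p hp hy))
      fun p hp hy => by
        refine (hn p hp hy).imp_right fun hn => ⟨?_, ?_⟩
        · rw [abs_mul, abs_exp]
          calc exp (S p / ε) * |fderiv ℝ S p v| ≤ 1 * C := by
                gcongr
                · exact h.exp_le_one hε hp hy
                · exact abs_apply_le_of_norm_le hn.1 hv
            _ ≤ _ := by rw [one_mul]; exact le_add_of_nonneg_right (by positivity)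
        · rw [hfd p hp hy]
          refine (norm_add_le _ _).trans ?_
          rw [norm_smul, norm_smul, norm_eq_abs, norm_eq_abs, abs_exp]
          calc _ ≤ 1 * C + C * (C / ε) := by
                gcongr
                · exact h.exp_le_one hε hp hy
                · exact hn.2
                · exact abs_apply_le_of_norm_le hn.1 hv
                · exact hnexp p hp hy hn.1
            _ = _ := by ring
    refine ⟨h1, h2, fun p hp hy => ?_⟩
    rw [h3 p hp hy, hfd p (le_of_lt hp) hy, (hexpd p (le_of_lt hp) hy).fderiv]
    simp only [add_apply, smul_apply, smul_eq_mul]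
    ring
  obtain ⟨hJ₁, hJ₁z, hJ₁d⟩ := hJ (1, 0) (by simp) fun p hp hy =>
    (h.near p hp hy).imp_right fun hn => ⟨hn.1, hn.2.1⟩
  obtain ⟨hJ₂, hJ₂z, hJ₂d⟩ := hJ (0, 1) (by simp) fun p hp hy =>
    (h.near p hp hy).imp_right fun hn => ⟨hn.1, hn.2.2.1⟩
  set φ : ℝ × ℝ → ℝ := lowerExt fun p => θ p * exp (S p / ε) with hφ
  set w : ℝ × ℝ → ℝ := fun p => u p - u0 p - φ p with hw
  have hu1 : ContDiffOn ℝ 1 u Ω := hu.of_le (by norm_num)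
  have hwd : ContDiffOn ℝ 1 w Ω := (hu1.sub hu0d).sub hφ1
  have hdiff : ∀ {F : ℝ × ℝ → ℝ}, ContDiffOn ℝ 1 F Ω → ∀ p ∈ Ω, DifferentiableAt ℝ F p :=
    fun hF p hp => (hF.contDiffAt (hΩ.mem_nhds hp)).differentiableAt one_ne_zero
  have hwfd : ∀ p ∈ Ω, ∀ v, fderiv ℝ w p v = fderiv ℝ u p v - fderiv ℝ u0 p v - fderiv ℝ φ p v := by
    intro p hp v
    rw [hw, fderiv_fun_sub ((hdiff hu1 p hp).fun_sub (hdiff hu0d p hp)) (hdiff hφ1 p hp),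
      fderiv_fun_sub (hdiff hu1 p hp) (hdiff hu0d p hp)]
    rfl
  set J : ℝ × ℝ → ℝ × ℝ → ℝ := fun v =>
    lowerExt fun p => θ p * (exp (S p / ε) * fderiv ℝ S p v) with hJdef
  have hQ : ∀ v, ContDiffOn ℝ 1 (J v) Ω →
      ContDiffOn ℝ 1 (fun p => ε * fderiv ℝ u p v - J v p) Ω := fun v hv =>
    (contDiffOn_const.mul (contDiffOn_fderiv_apply hΩ hu v)).sub hv
  have hQfd : ∀ v, ContDiffOn ℝ 1 (J v) Ω → ∀ p ∈ Ω,
      fderiv ℝ (fun p => ε * fderiv ℝ u p v - J v p) p v =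
        ε * fderiv ℝ (fun q => fderiv ℝ u q v) p v - fderiv ℝ (J v) p v := by
    intro v hv p hp
    have hd := hdiff (contDiffOn_fderiv_apply hΩ hu v) p hp
    rw [fderiv_fun_sub (hd.const_mul ε) (hdiff hv p hp), fderiv_const_mul hd]
    rfl
  have hP : ∀ v : ℝ × ℝ, ‖v‖ = 1 → ∀ p ∈ Ω, |fderiv ℝ u0 p v| ≤ C₀ →
      |ε * fderiv ℝ u p v - J v p - ε * fderiv ℝ w p v| ≤ (C₀ + C * B) * ε := by
    intro v hv p hp hb
    have hp' : p.1 ^ 2 / A ^ 2 + p.2 ^ 2 / B ^ 2 ≤ 1 := le_of_lt hp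
    rw [hwfd p hp v]
    by_cases hy : p.2 < 0
    · have hθ := abs_apply_le_of_norm_le (h.norm_fderiv_amp_le p hp' hy) hv
      have hyB := (abs_le_of_ellipse hA hB hp').2
      have e1 : ε * fderiv ℝ u p v - J v p -
          ε * (fderiv ℝ u p v - fderiv ℝ u0 p v - fderiv ℝ φ p v) =
          (fderiv ℝ u0 p v + exp (S p / ε) * fderiv ℝ θ p v) * ε := by
        rw [hφ3 p hp hy v, (hexpd p hp' hy).fderiv, hJdef]
        simp only
        rw [lowerExt_of_neg hy]
        simp only [smul_apply, smul_eq_mul]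
        field_simp
        ring
      rw [e1, abs_mul, abs_of_pos hε]
      refine mul_le_mul_of_nonneg_right ((abs_add_le _ _).trans (add_le_add hb ?_)) hε.le
      rw [abs_mul, abs_exp]
      calc exp (S p / ε) * |fderiv ℝ θ p v| ≤ 1 * (C * |p.2|) := by
            gcongr; exact h.exp_le_one hε hp' hy
        _ ≤ C * B := by rw [one_mul]; gcongr
    · rw [hφ2 p hp (not_lt.1 hy), hJdef]
      simp only
      rw [lowerExt_of_nonneg (not_lt.1 hy)]
      have e1 : ε * fderiv ℝ u p v - 0 -
          ε * (fderiv ℝ u p v - fderiv ℝ u0 p v - (0 : ℝ × ℝ →L[ℝ] ℝ) v) =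
          fderiv ℝ u0 p v * ε := by
        simp only [zero_apply]; ring
      rw [e1, abs_mul, abs_of_pos hε]
      gcongr
      exact hb.trans (le_add_of_nonneg_right (by positivity))
  obtain ⟨hLi, hLb⟩ := integral_layerProfile_le hA hB hε hΩdef hΩ.measurableSet
  have hsub : Ω ⊆ {p : ℝ × ℝ | p.1 ^ 2 / A ^ 2 + p.2 ^ 2 / B ^ 2 ≤ 1} := fun p hp =>
    show p.1 ^ 2 / A ^ 2 + p.2 ^ 2 / B ^ 2 ≤ 1 from le_of_lt hp
  refine ⟨hwd, ?_⟩
  refine lintegral_energy_le hΩ (isCompact_closedEllipse hA hB) hsub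
    (fun p hp => (abs_le_of_ellipse hA hB (le_of_lt hp)).2) hε hε1 hwd
    ((huc.sub hu0c.continuousOn).sub (h.continuousOn_corrector hε)) ?_
    (hQ (1, 0) hJ₁) (hQ (0, 1) hJ₂)
    (fun p hp => hP (1, 0) (by simp) p hp (hu0b p hp).1)
    (fun p hp => hP (0, 1) (by simp) p hp (hu0b p hp).2.1)
    (E := fun p => C₃ * layerProfile A B ε p) ?_ (hLi.const_mul _) ?_
  · intro p hp hp'
    have hp1 : p.1 ^ 2 / A ^ 2 + p.2 ^ 2 / B ^ 2 = 1 := le_antisymm hp (not_lt.1 hp')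
    simp only [hw, hφ]
    rw [hub p hp1]
    by_cases hy : p.2 < 0
    · obtain ⟨h1, h2⟩ := h.boundary p hp1 hy
      rw [lowerExt_of_neg hy, h1, h2]
      simp
    · rw [lowerExt_of_nonneg (not_lt.1 hy), hu0z p hp1 (not_lt.1 hy)]
      simp
  · intro p hp
    have hp' : p.1 ^ 2 / A ^ 2 + p.2 ^ 2 / B ^ 2 ≤ 1 := le_of_lt hp
    have hpd := hpde p hp
    rw [partialX_partialX_eq hΩ hu hp, partialY_partialY_eq hΩ hu hp,
      partialY_eq_fderiv (hdiff hu1 p hp)] at hpd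
    rw [hQfd _ hJ₁ p hp, hQfd _ hJ₂ p hp, hwfd p hp, (hu0b p hp).2.2]
    have e1 : ε * fderiv ℝ (fun q => fderiv ℝ u q (1, 0)) p (1, 0) - fderiv ℝ (J (1, 0)) p (1, 0) +
        (ε * fderiv ℝ (fun q => fderiv ℝ u q (0, 1)) p (0, 1) - fderiv ℝ (J (0, 1)) p (0, 1)) +
        (fderiv ℝ u p (0, 1) - -f p - fderiv ℝ φ p (0, 1)) =
        -(fderiv ℝ (J (1, 0)) p (1, 0) + fderiv ℝ (J (0, 1)) p (0, 1) +
          fderiv ℝ φ p (0, 1)) := by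
      rw [← hpd]; ring
    rw [e1, neg_sq]
    by_cases hy : p.2 < 0
    · have e2 : fderiv ℝ (J (1, 0)) p (1, 0) + fderiv ℝ (J (0, 1)) p (0, 1) +
          fderiv ℝ φ p (0, 1) = θ p * exp (S p / ε) / ε *
            (fderiv ℝ S p (1, 0) ^ 2 + fderiv ℝ S p (0, 1) ^ 2 + fderiv ℝ S p (0, 1)) +
          exp (S p / ε) * (fderiv ℝ θ p (1, 0) * fderiv ℝ S p (1, 0) +
            fderiv ℝ θ p (0, 1) * (fderiv ℝ S p (0, 1) + 1)) +
          θ p * exp (S p / ε) * (fderiv ℝ (fun q => fderiv ℝ S q (1, 0)) p (1, 0) +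
            fderiv ℝ (fun q => fderiv ℝ S q (0, 1)) p (0, 1)) := by
        rw [hJdef]
        simp only
        rw [hJ₁d p hp hy, hJ₂d p hp hy, hφ3 p hp hy, (hexpd p hp' hy).fderiv]
        simp only [smul_apply, smul_eq_mul]
        ring
      rw [e2, layerProfile, if_pos hy]
      rcases h.near p hp' hy with hz | ⟨hn1, hn2, hn3, hn4⟩
      · have : 0 ≤ C₃ * (p.2 ^ 2 *
            exp (p.2 * (1 - p.1 ^ 2 / A ^ 2 - p.2 ^ 2 / B ^ 2) / (2 * ε))) := by positivity
        simpa [hz.eq_of_nhds, hz.fderiv_eq] using this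
      · have hle : ∀ {t : ℝ}, 0 ≤ t → C * t ≤ 2 * C * t := fun ht => by nlinarith
        have hθ := h.norm_fderiv_amp_le p hp' hy
        have hv1 : ‖((1 : ℝ), (0 : ℝ))‖ = 1 := by simp
        have hv2 : ‖((0 : ℝ), (1 : ℝ))‖ = 1 := by simp
        refine residual_sq_le hε (by positivity) (abs_le_of_ellipse hA hB hp').2
          (h.phase_le p hp' hy) (h.phase_nonpos hp' hy)
          ((h.abs_amp_le p hp' hy).trans (hle (by positivity)))
          ((abs_apply_le_of_norm_le hθ hv1).trans (hle (by positivity)))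
          ((abs_apply_le_of_norm_le hθ hv2).trans (hle (by positivity)))
          ((abs_apply_le_of_norm_le hn1 hv1).trans (by linarith))
          ((abs_apply_le_of_norm_le hn1 hv2).trans (by linarith)) ?_
          (hn4.trans (hle (by positivity)))
        refine (abs_add_le _ _).trans ?_
        linarith [abs_apply_le_of_norm_le hn2 hv1, abs_apply_le_of_norm_le hn3 hv2]
    · have hy' := not_lt.1 hy
      rw [hJdef]
      simp only
      rw [hJ₁z p hp hy', hJ₂z p hp hy', hφ2 p hp hy', layerProfile, if_neg hy]
      simp
  · rw [integral_const_mul, mul_assoc]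
    exact mul_le_mul_of_nonneg_left hLb (by positivity)

/-- Discriminant of the quadratic equation satisfied by `ellM`. -/
noncomputable def ellD (a : ℝ) (p : ℝ × ℝ) : ℝ :=
  √((p.1 ^ 2 + p.2 ^ 2 - a ^ 2) ^ 2 + 4 * a ^ 2 * p.2 ^ 2)

/-- The square of `a * sinh ρ`, where `(ρ, τ)` are the elliptic coordinates of a point. -/
noncomputable def ellM (a : ℝ) (p : ℝ × ℝ) : ℝ := (p.1 ^ 2 + p.2 ^ 2 - a ^ 2 + ellD a p) / 2

/-- The sine of the angular elliptic coordinate. -/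
noncomputable def ellSin (a : ℝ) (p : ℝ × ℝ) : ℝ := p.2 / √(ellM a p)

/-- The cosine of the angular elliptic coordinate. -/
noncomputable def ellCos (a : ℝ) (p : ℝ × ℝ) : ℝ := p.1 / √(ellM a p + a ^ 2)

/-- The radial elliptic coordinate. -/
noncomputable def ellRho (a : ℝ) (p : ℝ × ℝ) : ℝ := arsinh (√(ellM a p) / a)

section EllipticCoordinates

variable {a : ℝ} {p : ℝ × ℝ}

lemma ellD_sq (a : ℝ) (p : ℝ × ℝ) :
    ellD a p ^ 2 = (p.1 ^ 2 + p.2 ^ 2 - a ^ 2) ^ 2 + 4 * a ^ 2 * p.2 ^ 2 :=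
  sq_sqrt (by positivity)

lemma ellD_nonneg (a : ℝ) (p : ℝ × ℝ) : 0 ≤ ellD a p := sqrt_nonneg _

lemma abs_le_ellD (a : ℝ) (p : ℝ × ℝ) : |p.1 ^ 2 + p.2 ^ 2 - a ^ 2| ≤ ellD a p :=
  abs_le_of_sq_le_sq (by rw [ellD_sq]; nlinarith [sq_nonneg (a * p.2)]) (ellD_nonneg a p)

lemma ellM_nonneg (a : ℝ) (p : ℝ × ℝ) : 0 ≤ ellM a p := by
  unfold ellM
  linarith [neg_abs_le (p.1 ^ 2 + p.2 ^ 2 - a ^ 2), abs_le_ellD a p]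

lemma ellM_quadratic (a : ℝ) (p : ℝ × ℝ) :
    ellM a p ^ 2 = (p.1 ^ 2 + p.2 ^ 2 - a ^ 2) * ellM a p + a ^ 2 * p.2 ^ 2 := by
  unfold ellM
  nlinarith [ellD_sq a p]

lemma ellM_pos (ha : 0 < a) (hy : p.2 ≠ 0) : 0 < ellM a p := by
  refine (ellM_nonneg a p).lt_of_ne fun h => ?_
  have := ellM_quadratic a p
  rw [← h] at this
  have : 0 < a ^ 2 * p.2 ^ 2 := by positivity
  linarith

lemma ellM_mul_ellD (a : ℝ) (p : ℝ × ℝ) :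
    ellM a p * ellD a p = ellM a p ^ 2 + a ^ 2 * p.2 ^ 2 := by
  have : ellD a p = 2 * ellM a p - (p.1 ^ 2 + p.2 ^ 2 - a ^ 2) := by unfold ellM; ring
  rw [this]
  linarith [ellM_quadratic a p]

lemma ellM_le_ellD (hM : 0 < ellM a p) : ellM a p ≤ ellD a p := by
  have h := ellM_mul_ellD a p
  have : 0 ≤ a ^ 2 * p.2 ^ 2 := by positivity
  refine le_of_mul_le_mul_left ?_ hM
  nlinarith

lemma sq_eq_ellSin (hM : 0 < ellM a p) : p.2 ^ 2 = ellSin a p ^ 2 * ellM a p := by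
  rw [ellSin, div_pow, sq_sqrt hM.le]
  field_simp

lemma sq_eq_ellCos (hM : 0 < ellM a p) : p.1 ^ 2 = ellCos a p ^ 2 * (ellM a p + a ^ 2) := by
  have : 0 < ellM a p + a ^ 2 := by positivity
  rw [ellCos, div_pow, sq_sqrt this.le]
  field_simp

lemma snd_eq_ellSin (hM : 0 < ellM a p) : p.2 = ellSin a p * √(ellM a p) := by
  have := sqrt_pos.2 hM
  rw [ellSin]; field_simp

lemma fst_eq_ellCos (hM : 0 < ellM a p) : p.1 = ellCos a p * √(ellM a p + a ^ 2) := by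
  have : 0 < √(ellM a p + a ^ 2) := sqrt_pos.2 (by positivity)
  rw [ellCos]; field_simp

lemma ellCos_sq_add_ellSin_sq (hM : 0 < ellM a p) : ellCos a p ^ 2 + ellSin a p ^ 2 = 1 := by
  have h2 : 0 < ellM a p + a ^ 2 := by positivity
  rw [ellSin, ellCos, div_pow, div_pow, sq_sqrt hM.le, sq_sqrt h2.le]
  field_simp
  linarith [ellM_quadratic a p]

lemma abs_ellSin_le_one (hM : 0 < ellM a p) : |ellSin a p| ≤ 1 := by
  have := ellCos_sq_add_ellSin_sq hM
  refine abs_le_of_sq_le_sq ?_ zero_le_one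
  nlinarith [sq_nonneg (ellCos a p)]

lemma ellD_eq (hM : 0 < ellM a p) : ellD a p = ellM a p + a ^ 2 * ellSin a p ^ 2 := by
  have h := ellM_mul_ellD a p
  rw [sq_eq_ellSin hM] at h
  refine mul_left_cancel₀ hM.ne' ?_
  rw [h]; ring

lemma continuous_ellM (a : ℝ) : Continuous (ellM a) := by
  unfold ellM ellD
  fun_prop

lemma contDiffAt_ellM (hM : 0 < ellM a p) {n : WithTop ℕ∞} : ContDiffAt ℝ n (ellM a) p := by
  have hD : 0 < ellD a p := hM.trans_le (ellM_le_ellD hM)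
  unfold ellM ellD
  refine ContDiffAt.div_const (ContDiffAt.add (by fun_prop) (ContDiffAt.sqrt (by fun_prop) ?_)) _
  exact (sqrt_pos.1 hD).ne'

lemma contDiffAt_ellSin (hM : 0 < ellM a p) {n : WithTop ℕ∞} : ContDiffAt ℝ n (ellSin a) p :=
  contDiffAt_snd.div ((contDiffAt_ellM hM).sqrt hM.ne') (sqrt_pos.2 hM).ne'

lemma contDiffAt_ellCos (hM : 0 < ellM a p) {n : WithTop ℕ∞} : ContDiffAt ℝ n (ellCos a) p := by
  have h2 : 0 < ellM a p + a ^ 2 := by positivity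
  exact contDiffAt_fst.div (((contDiffAt_ellM hM).add contDiffAt_const).sqrt h2.ne')
    (sqrt_pos.2 h2).ne'

lemma contDiffAt_ellRho (hM : 0 < ellM a p) {n : ℕ∞} : ContDiffAt ℝ n (ellRho a) p :=
  (((contDiffAt_ellM hM).sqrt hM.ne').div_const a).arsinh

lemma hasDerivAt_arsinh_sqrt {g : ℝ → ℝ} {g' t : ℝ} (ha : 0 < a) (hg : HasDerivAt g g' t)
    (h : 0 < g t) :
    HasDerivAt (fun t => arsinh (√(g t) / a)) (g' / (2 * √(g t) * √(g t + a ^ 2))) t := by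
  have h1 := ((hg.sqrt h.ne').div_const a).arsinh
  refine h1.congr_deriv ?_
  have h2 : 1 + (√(g t) / a) ^ 2 = (g t + a ^ 2) / a ^ 2 := by
    rw [div_pow, sq_sqrt h.le]; field_simp; ring
  rw [h2, sqrt_div (by positivity), sqrt_sq ha.le, smul_eq_mul]
  have : 0 < √(g t) := sqrt_pos.2 h
  have : 0 < √(g t + a ^ 2) := sqrt_pos.2 (by positivity)
  field_simp

lemma fderiv_ellRho_fst (ha : 0 < a) (hM : 0 < ellM a p) :
    fderiv ℝ (ellRho a) p (1, 0) = ellCos a p * √(ellM a p) / ellD a p := by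
  have hD : 0 < ellD a p := hM.trans_le (ellM_le_ellD hM)
  have hD2 : 0 < (p.1 ^ 2 + p.2 ^ 2 - a ^ 2) ^ 2 + 4 * a ^ 2 * p.2 ^ 2 := sqrt_pos.1 hD
  have hE : HasDerivAt (fun x : ℝ => x ^ 2 + p.2 ^ 2 - a ^ 2) (2 * p.1) p.1 := by
    have := (((hasDerivAt_id p.1).fun_pow 2).add_const (p.2 ^ 2)).sub_const (a ^ 2)
    simpa using this
  have hMd : HasDerivAt (fun x : ℝ => ellM a (x, p.2)) (2 * p.1 * ellM a p / ellD a p) p.1 := by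
    have h1 := (((hE.fun_pow 2).add_const (4 * a ^ 2 * p.2 ^ 2)).sqrt hD2.ne')
    have h2 := (hE.fun_add h1).div_const 2
    refine h2.congr_deriv ?_
    rw [show √((p.1 ^ 2 + p.2 ^ 2 - a ^ 2) ^ 2 + 4 * a ^ 2 * p.2 ^ 2) = ellD a p from rfl]
    unfold ellM
    field_simp
    ring
  rw [← partialX_eq_fderiv ((contDiffAt_ellRho hM (n := 1)).differentiableAt one_ne_zero)]
  refine (hasDerivAt_arsinh_sqrt ha hMd hM).deriv.trans ?_
  have h3 : 0 < √(ellM a p) := sqrt_pos.2 hM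
  have h4 : 0 < √(ellM a p + a ^ 2) := sqrt_pos.2 (by positivity)
  simp only [Prod.mk.eta, ellCos]
  field_simp
  rw [sq_sqrt hM.le]

lemma fderiv_ellRho_snd (ha : 0 < a) (hM : 0 < ellM a p) :
    fderiv ℝ (ellRho a) p (0, 1) = ellSin a p * √(ellM a p + a ^ 2) / ellD a p := by
  have hD : 0 < ellD a p := hM.trans_le (ellM_le_ellD hM)
  have hD2 : 0 < (p.1 ^ 2 + p.2 ^ 2 - a ^ 2) ^ 2 + 4 * a ^ 2 * p.2 ^ 2 := sqrt_pos.1 hD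
  have hE : HasDerivAt (fun y : ℝ => p.1 ^ 2 + y ^ 2 - a ^ 2) (2 * p.2) p.2 := by
    have := (((hasDerivAt_id p.2).fun_pow 2).const_add (p.1 ^ 2)).sub_const (a ^ 2)
    simpa using this
  have hMd : HasDerivAt (fun y : ℝ => ellM a (p.1, y))
      (2 * p.2 * (ellM a p + a ^ 2) / ellD a p) p.2 := by
    have h0 : HasDerivAt (fun y : ℝ => 4 * a ^ 2 * y ^ 2) (4 * a ^ 2 * (2 * p.2)) p.2 := by
      have := ((hasDerivAt_id p.2).fun_pow 2).const_mul (4 * a ^ 2)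
      simpa using this
    have h1 := (((hE.fun_pow 2).fun_add h0).sqrt hD2.ne')
    have h2 := (hE.fun_add h1).div_const 2
    refine h2.congr_deriv ?_
    rw [show √((p.1 ^ 2 + p.2 ^ 2 - a ^ 2) ^ 2 + 4 * a ^ 2 * p.2 ^ 2) = ellD a p from rfl]
    unfold ellM
    field_simp
    ring
  rw [← partialY_eq_fderiv ((contDiffAt_ellRho hM (n := 1)).differentiableAt one_ne_zero)]
  refine (hasDerivAt_arsinh_sqrt ha hMd hM).deriv.trans ?_
  have h3 : 0 < √(ellM a p) := sqrt_pos.2 hM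
  have h4 : 0 < √(ellM a p + a ^ 2) := sqrt_pos.2 (by positivity)
  simp only [Prod.mk.eta, ellSin]
  field_simp
  rw [sq_sqrt (by positivity)]

lemma fderiv_ellRho_sq (ha : 0 < a) (hM : 0 < ellM a p) :
    fderiv ℝ (ellRho a) p (1, 0) ^ 2 + fderiv ℝ (ellRho a) p (0, 1) ^ 2 = 1 / ellD a p := by
  have hD : 0 < ellD a p := hM.trans_le (ellM_le_ellD hM)
  rw [fderiv_ellRho_fst ha hM, fderiv_ellRho_snd ha hM, div_pow, div_pow, mul_pow, mul_pow,
    sq_sqrt hM.le, sq_sqrt (by positivity)]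
  field_simp
  nlinarith [ellD_eq hM, ellCos_sq_add_ellSin_sq hM]

lemma sinh_ellRho (ha : 0 < a) : a * sinh (ellRho a p) = √(ellM a p) := by
  rw [ellRho, sinh_arsinh]; field_simp

lemma cosh_ellRho (ha : 0 < a) : a * cosh (ellRho a p) = √(ellM a p + a ^ 2) := by
  have h : 0 ≤ a * cosh (ellRho a p) := by positivity
  rw [eq_comm, sqrt_eq_iff_mul_self_eq (add_nonneg (ellM_nonneg a p) (sq_nonneg a)) h]
  have := sinh_ellRho (p := p) ha
  have h2 : (a * sinh (ellRho a p)) ^ 2 = ellM a p := by rw [this, sq_sqrt (ellM_nonneg a p)]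
  nlinarith [cosh_sq (ellRho a p)]

lemma ellRho_nonneg (ha : 0 < a) : 0 ≤ ellRho a p :=
  arsinh_nonneg_iff.2 (by positivity)

lemma ellRho_pos (ha : 0 < a) (hM : 0 < ellM a p) : 0 < ellRho a p := by
  have := sqrt_pos.2 hM
  exact arsinh_pos_iff.2 (by positivity)

lemma sinh_sub_le {x y : ℝ} (hx : 0 ≤ x) (h : x ≤ y) : sinh y - sinh x ≤ cosh y * (y - x) := by
  have hd : ∀ t ∈ Ico x y, deriv sinh t ≤ cosh y := fun t ht => by
    rw [Real.deriv_sinh]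
    exact cosh_le_cosh.2 (by rw [abs_of_nonneg (hx.trans ht.1), abs_of_nonneg (hx.trans h)]
                             exact ht.2.le)
  exact (convex_Icc x y).image_sub_le_mul_sub_of_deriv_le continuous_sinh.continuousOn
    differentiable_sinh.differentiableOn (fun t ht => by
      rw [interior_Icc] at ht
      exact hd t ⟨ht.1.le, ht.2⟩) x (left_mem_Icc.2 h) y (right_mem_Icc.2 h) h

lemma cosh_sub_le {x y : ℝ} (h : x ≤ y) : cosh y - cosh x ≤ sinh y * (y - x) := by
  refine (convex_Icc x y).image_sub_le_mul_sub_of_deriv_le continuous_cosh.continuousOn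
    differentiable_cosh.differentiableOn (fun t ht => ?_) x (left_mem_Icc.2 h) y
    (right_mem_Icc.2 h) h
  rw [interior_Icc] at ht
  rw [Real.deriv_cosh]
  exact sinh_le_sinh.2 ht.2.le

end EllipticCoordinates

section Ellipse

variable {a R : ℝ} {p : ℝ × ℝ}

/-- The defining function of the ellipse in elliptic coordinates. -/
lemma one_sub_ellipse_eq (ha : 0 < a) (hR : 0 < R) (hM : 0 < ellM a p) :
    1 - p.1 ^ 2 / (a * cosh R) ^ 2 - p.2 ^ 2 / (a * sinh R) ^ 2 =
      ((a * sinh R) ^ 2 - ellM a p) *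
        (ellCos a p ^ 2 / (a * cosh R) ^ 2 + ellSin a p ^ 2 / (a * sinh R) ^ 2) := by
  have hA : 0 < a * cosh R := by positivity
  have hB : 0 < a * sinh R := mul_pos ha (sinh_pos_iff.2 hR)
  have hAB : (a * cosh R) ^ 2 = (a * sinh R) ^ 2 + a ^ 2 := by rw [mul_pow, cosh_sq]; ring
  have h1 := ellCos_sq_add_ellSin_sq hM
  rw [sq_eq_ellSin hM, sq_eq_ellCos hM]
  set A := a * cosh R
  set B := a * sinh R
  set c := ellCos a p
  set s := ellSin a p
  field_simp
  have h2 : c ^ 2 = 1 - s ^ 2 := by linarith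
  rw [h2, hAB]
  ring

lemma ellipse_factor_pos (ha : 0 < a) (hR : 0 < R) (hM : 0 < ellM a p) :
    0 < ellCos a p ^ 2 / (a * cosh R) ^ 2 + ellSin a p ^ 2 / (a * sinh R) ^ 2 := by
  have hA : 0 < a * cosh R := by positivity
  have hB : 0 < a * sinh R := mul_pos ha (sinh_pos_iff.2 hR)
  have h1 := ellCos_sq_add_ellSin_sq hM
  rcases eq_or_ne (ellCos a p) 0 with h | h
  · have : ellSin a p ^ 2 = 1 := by rw [h] at h1; linarith
    rw [this]; positivity
  · positivity

lemma ellM_le_of_mem (ha : 0 < a) (hR : 0 < R) (hM : 0 < ellM a p)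
    (hp : p.1 ^ 2 / (a * cosh R) ^ 2 + p.2 ^ 2 / (a * sinh R) ^ 2 ≤ 1) :
    ellM a p ≤ (a * sinh R) ^ 2 := by
  have h := one_sub_ellipse_eq ha hR hM
  have hf := ellipse_factor_pos ha hR hM
  by_contra hlt
  have := mul_neg_of_neg_of_pos (sub_neg.2 (not_le.1 hlt)) hf
  linarith

lemma ellM_lt_of_mem (ha : 0 < a) (hR : 0 < R) (hM : 0 < ellM a p)
    (hp : p.1 ^ 2 / (a * cosh R) ^ 2 + p.2 ^ 2 / (a * sinh R) ^ 2 < 1) :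
    ellM a p < (a * sinh R) ^ 2 := by
  refine (ellM_le_of_mem ha hR hM hp.le).lt_of_ne fun he => ?_
  have h := one_sub_ellipse_eq ha hR hM
  rw [he, sub_self, zero_mul] at h
  linarith

lemma ellM_eq_of_mem (ha : 0 < a) (hR : 0 < R) (hM : 0 < ellM a p)
    (hp : p.1 ^ 2 / (a * cosh R) ^ 2 + p.2 ^ 2 / (a * sinh R) ^ 2 = 1) :
    ellM a p = (a * sinh R) ^ 2 := by
  have h := one_sub_ellipse_eq ha hR hM
  rw [show 1 - p.1 ^ 2 / (a * cosh R) ^ 2 - p.2 ^ 2 / (a * sinh R) ^ 2 = 0 by linarith] at h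
  rcases mul_eq_zero.1 h.symm with h | h
  · linarith
  · exact absurd h (ellipse_factor_pos ha hR hM).ne'

lemma ellRho_le_of_ellM_le (ha : 0 < a) {r : ℝ} (hr : 0 ≤ r) (h : ellM a p ≤ (a * sinh r) ^ 2) :
    ellRho a p ≤ r := by
  rw [← sinh_le_sinh]
  refine le_of_mul_le_mul_left ?_ ha
  rw [sinh_ellRho ha]
  exact (sqrt_le_left (mul_nonneg ha.le (sinh_nonneg_iff.2 hr))).2 h

lemma ellRho_lt_of_ellM_lt (ha : 0 < a) {r : ℝ} (hr : 0 < r) (h : ellM a p < (a * sinh r) ^ 2) :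
    ellRho a p < r := by
  rw [← sinh_lt_sinh]
  refine lt_of_mul_lt_mul_left ?_ ha.le
  rw [sinh_ellRho ha]
  exact (sqrt_lt' (mul_pos ha (sinh_pos_iff.2 hr))).2 h

lemma ellRho_eq_of_mem (ha : 0 < a) (hR : 0 < R) (hM : ellM a p = (a * sinh R) ^ 2) :
    ellRho a p = R := by
  have hB : 0 < a * sinh R := mul_pos ha (sinh_pos_iff.2 hR)
  rw [ellRho, hM, sqrt_sq hB.le, mul_div_cancel_left₀ _ ha.ne', arsinh_sinh]

/-- Lower bound for the layer exponent. -/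
lemma ellPhase_le (ha : 0 < a) (hR : 0 < R)
    (hp : p.1 ^ 2 / (a * cosh R) ^ 2 + p.2 ^ 2 / (a * sinh R) ^ 2 ≤ 1) (hy : p.2 < 0) :
    a * cosh R * ellSin a p * (R - ellRho a p) ≤
      p.2 * (1 - p.1 ^ 2 / (a * cosh R) ^ 2 - p.2 ^ 2 / (a * sinh R) ^ 2) / 2 := by
  have hM := ellM_pos ha hy.ne
  have hB : 0 < a * sinh R := mul_pos ha (sinh_pos_iff.2 hR)
  have hMB := ellM_le_of_mem ha hR hM hp
  have hρ := ellRho_le_of_ellM_le ha hR.le hMB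
  have hq := one_sub_ellipse_eq ha hR hM
  have hs := sinh_sub_le (ellRho_nonneg ha) hρ
  have hn := sinh_ellRho (p := p) ha
  have hn0 : 0 < √(ellM a p) := sqrt_pos.2 hM
  have hnn : √(ellM a p) ^ 2 = ellM a p := sq_sqrt hM.le
  have hnB : √(ellM a p) ≤ a * sinh R := (sqrt_le_left hB.le).2 hMB
  have hcs := ellCos_sq_add_ellSin_sq hM
  have hy' := snd_eq_ellSin hM
  have hAB : a * sinh R ≤ a * cosh R := by gcongr; exact (sinh_lt_cosh R).le
  set q := 1 - p.1 ^ 2 / (a * cosh R) ^ 2 - p.2 ^ 2 / (a * sinh R) ^ 2 with hqd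
  set n := √(ellM a p)
  set η := R - ellRho a p with hη
  have hη0 : 0 ≤ η := by linarith
  have h1 : a * sinh R - n ≤ a * cosh R * η := by rw [← hn]; nlinarith
  set A := a * cosh R
  set B := a * sinh R
  set s := ellSin a p
  set c := ellCos a p
  have h2 : q ≤ (B ^ 2 - ellM a p) / B ^ 2 := by
    rw [hq, div_eq_mul_inv]
    refine mul_le_mul_of_nonneg_left ?_ (by linarith)
    calc c ^ 2 / A ^ 2 + s ^ 2 / B ^ 2 ≤ c ^ 2 / B ^ 2 + s ^ 2 / B ^ 2 := by gcongr
      _ = (B ^ 2)⁻¹ := by rw [← add_div, hcs, one_div]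
  have h3 : B ^ 2 - ellM a p ≤ 2 * B * (A * η) := by
    rw [← hnn]
    nlinarith
  have h4 : B * q ≤ 2 * A * η := by
    have : q ≤ 2 * B * (A * η) / B ^ 2 := h2.trans (by gcongr)
    rw [le_div_iff₀ (by positivity)] at this
    refine le_of_mul_le_mul_left ?_ hB
    linarith
  have hs0 : s < 0 := by
    by_contra h
    nlinarith [mul_nonneg (not_lt.1 h) hn0.le]
  have hq0 : 0 ≤ q := by rw [hqd]; linarith
  have h5 : n * q ≤ 2 * A * η := (mul_le_mul_of_nonneg_right hnB hq0).trans h4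
  rw [hy']
  nlinarith

end Ellipse

section LayerData

variable {a R : ℝ}

lemma exists_bound_away_from_focal_segment {A B b : ℝ} (hA : 0 < A) (hB : 0 < B) (hb : 0 < b)
    {g : ℝ × ℝ → ℝ} (hg : ∀ p, 0 < ellM a p → ContDiffAt ℝ 1 g p) :
    ∃ C, 0 ≤ C ∧ ∀ p : ℝ × ℝ, p.1 ^ 2 / A ^ 2 + p.2 ^ 2 / B ^ 2 ≤ 1 → b ≤ ellM a p →
      ‖fderiv ℝ g p‖ ≤ C := by
  have hK : IsCompact ({p : ℝ × ℝ | p.1 ^ 2 / A ^ 2 + p.2 ^ 2 / B ^ 2 ≤ 1} ∩ ellM a ⁻¹' Ici b) :=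
    (isCompact_closedEllipse hA hB).inter_right (isClosed_Ici.preimage (continuous_ellM a))
  obtain ⟨C, hC⟩ := hK.exists_bound_of_continuousOn (f := fderiv ℝ g) fun p hp =>
    ((hg p (hb.trans_le hp.2)).continuousAt_fderiv one_ne_zero).continuousWithinAt
  exact ⟨|C|, abs_nonneg C, fun p hp hM => (hC p ⟨hp, hM⟩).trans (le_abs_self C)⟩

lemma isOpen_ellM_pos (a : ℝ) : IsOpen {p : ℝ × ℝ | 0 < ellM a p} :=
  isOpen_lt continuous_const (continuous_ellM a)

lemma ellSin_neg (ha : 0 < a) {p : ℝ × ℝ} (hy : p.2 < 0) : ellSin a p < 0 :=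
  div_neg_of_neg_of_pos hy (sqrt_pos.2 (ellM_pos ha hy.ne))

/-- The phase of the boundary layer. -/
noncomputable def layerPhase (a R : ℝ) (p : ℝ × ℝ) : ℝ :=
  a * cosh R * ellSin a p * (R - ellRho a p)

/-- The amplitude of the boundary layer, for the source `f` and the cutoff `δ`. -/
noncomputable def layerAmp (a R : ℝ) (f : ℝ × ℝ → ℝ) (δ : ℝ → ℝ) (p : ℝ × ℝ) : ℝ :=
  ellSin a p * (a * sinh R * (∫ t in (-1 : ℝ)..1,
    f (a * cosh R * ellCos a p, a * sinh R * ellSin a p * t)) * δ (R - ellRho a p))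

lemma contDiffAt_layerPhase {p : ℝ × ℝ} (hM : 0 < ellM a p) : ContDiffAt ℝ 2 (layerPhase a R) p :=
  (contDiffAt_const.mul (contDiffAt_ellSin hM)).mul
    (contDiffAt_const.sub (contDiffAt_ellRho hM (n := 2)))

lemma contDiffAt_layerAmp_factor {f : ℝ × ℝ → ℝ} (hf : ContDiff ℝ 1 f) {δ : ℝ → ℝ}
    (hδ : ContDiff ℝ 1 δ) {p : ℝ × ℝ} (hM : 0 < ellM a p) :
    ContDiffAt ℝ 1 (fun p => a * sinh R * (∫ t in (-1 : ℝ)..1,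
      f (a * cosh R * ellCos a p, a * sinh R * ellSin a p * t)) * δ (R - ellRho a p)) p := by
  refine (contDiffAt_const.mul ?_).mul
    (hδ.contDiffAt.comp p (contDiffAt_const.sub (contDiffAt_ellRho hM (n := 1))))
  exact ContDiffAt.comp p
    (f := fun p => (a * cosh R * ellCos a p, a * sinh R * ellSin a p))
    (contDiff_one_scaled_integral hf (-1) 1).contDiffAt
    ((contDiffAt_const.mul (contDiffAt_ellCos hM)).prodMk
      (contDiffAt_const.mul (contDiffAt_ellSin hM)))

lemma contDiffAt_layerAmp {f : ℝ × ℝ → ℝ} (hf : ContDiff ℝ 1 f) {δ : ℝ → ℝ}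
    (hδ : ContDiff ℝ 1 δ) {p : ℝ × ℝ} (hM : 0 < ellM a p) :
    ContDiffAt ℝ 1 (layerAmp a R f δ) p :=
  (contDiffAt_ellSin hM).mul (contDiffAt_layerAmp_factor hf hδ hM)

lemma fderiv_layerPhase {p : ℝ × ℝ} (hM : 0 < ellM a p) (v : ℝ × ℝ) :
    fderiv ℝ (layerPhase a R) p v = a * cosh R *
      ((R - ellRho a p) * fderiv ℝ (ellSin a) p v - ellSin a p * fderiv ℝ (ellRho a) p v) := by
  have hs := ((contDiffAt_ellSin hM (n := 1)).differentiableAt one_ne_zero).hasFDerivAt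
  have hρ := ((contDiffAt_ellRho hM (n := 1)).differentiableAt one_ne_zero).hasFDerivAt
  have h := (hs.const_mul (a * cosh R)).mul (hρ.const_sub R)
  have h' : HasFDerivAt (layerPhase a R) _ p := h
  rw [h'.fderiv]
  simp only [add_apply, smul_apply, neg_apply, smul_eq_mul]
  ring

/-- The layer phase satisfies the eikonal equation up to a multiple of itself. -/
lemma layerPhase_eikonal (ha : 0 < a) (hR : 0 < R) {C b : ℝ} (hb : 0 < b) {p : ℝ × ℝ}
    (hp : p.1 ^ 2 / (a * cosh R) ^ 2 + p.2 ^ 2 / (a * sinh R) ^ 2 ≤ 1) (hM : b ≤ ellM a p)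
    (hs : ‖fderiv ℝ (ellSin a) p‖ ≤ C) (hρ : ‖fderiv ℝ (ellRho a) p‖ ≤ C) :
    |p.2| * |fderiv ℝ (layerPhase a R) p (1, 0) ^ 2 + fderiv ℝ (layerPhase a R) p (0, 1) ^ 2 +
        fderiv ℝ (layerPhase a R) p (0, 1)| ≤
      a * sinh R / (a * cosh R) * ((a * cosh R) ^ 2 * R * (2 * C ^ 2) +
        4 * (a * cosh R) ^ 2 * C ^ 2 + a * cosh R * C + a * cosh R * (a * sinh R) / b) *
        |layerPhase a R p| := by
  have hM0 : 0 < ellM a p := hb.trans_le hM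
  have hB : 0 < a * sinh R := mul_pos ha (sinh_pos_iff.2 hR)
  have hA : 0 < a * cosh R := by positivity
  have hMB := ellM_le_of_mem ha hR hM0 hp
  have hρR := ellRho_le_of_ellM_le ha hR.le hMB
  have hρ0 := ellRho_nonneg (p := p) ha
  have hD : b ≤ ellD a p := hM.trans (ellM_le_ellD hM0)
  have hD0 : 0 < ellD a p := hb.trans_le hD
  have hs1 := abs_ellSin_le_one hM0
  have hm := cosh_ellRho (p := p) ha
  have hch := mul_le_mul_of_nonneg_left (cosh_sub_le hρR) ha.le
  have hmono : cosh (ellRho a p) ≤ cosh R :=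
    cosh_le_cosh.2 (by rwa [abs_of_nonneg hρ0, abs_of_pos hR])
  have hmA : √(ellM a p + a ^ 2) ≤ a * cosh R := by rw [← hm]; gcongr
  have hAm : a * cosh R - √(ellM a p + a ^ 2) ≤ a * sinh R * (R - ellRho a p) := by
    rw [← hm]; linarith
  have hy : |p.2| ≤ a * sinh R * |ellSin a p| := by
    rw [snd_eq_ellSin hM0, abs_mul, abs_of_nonneg (sqrt_nonneg _), mul_comm]
    gcongr
    exact (sqrt_le_left hB.le).2 hMB
  have hrs := fderiv_ellRho_sq ha hM0
  have hry := fderiv_ellRho_snd ha hM0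
  have hsx := abs_apply_le_of_norm_le hs (v := (1, 0)) (by simp)
  have hsy := abs_apply_le_of_norm_le hs (v := (0, 1)) (by simp)
  have hrx := abs_apply_le_of_norm_le hρ (v := (1, 0)) (by simp)
  have hry' := abs_apply_le_of_norm_le hρ (v := (0, 1)) (by simp)
  have hC : 0 ≤ C := (abs_nonneg _).trans hsx
  rw [fderiv_layerPhase hM0, fderiv_layerPhase hM0]
  have habs : |layerPhase a R p| = a * cosh R * |ellSin a p| * (R - ellRho a p) := by
    rw [layerPhase, abs_mul, abs_mul, abs_of_pos hA, abs_of_nonneg (sub_nonneg.2 hρR)]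
  rw [habs]
  set A := a * cosh R
  set B := a * sinh R
  set s := ellSin a p
  set m := √(ellM a p + a ^ 2)
  set η := R - ellRho a p
  set sx := fderiv ℝ (ellSin a) p (1, 0)
  set sy := fderiv ℝ (ellSin a) p (0, 1)
  set rx := fderiv ℝ (ellRho a) p (1, 0)
  set ry := fderiv ℝ (ellRho a) p (0, 1)
  set D := ellD a p
  have hη : 0 ≤ η := sub_nonneg.2 hρR
  have hηR : η ≤ R := by simp only [η]; linarith
  have hid : (A * (η * sx - s * rx)) ^ 2 + (A * (η * sy - s * ry)) ^ 2 + A * (η * sy - s * ry) =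
      A ^ 2 * η * (sx ^ 2 + sy ^ 2) * η - 2 * A ^ 2 * s * (sx * rx + sy * ry) * η + A * sy * η +
        A * s ^ 2 * ((A - m) / D) := by
    have : A ^ 2 * s ^ 2 * (rx ^ 2 + ry ^ 2) - A * s * ry = A * s ^ 2 * ((A - m) / D) := by
      rw [hrs, hry]; field_simp
    rw [← this]; ring
  have hq : (A - m) / D ≤ B * η / b := by gcongr
  have hq0 : 0 ≤ (A - m) / D := div_nonneg (sub_nonneg.2 hmA) hD0.le
  have hs2 : s ^ 2 ≤ 1 := by rw [← sq_abs]; exact pow_le_one₀ (abs_nonneg s) hs1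
  have hX : |(A * (η * sx - s * rx)) ^ 2 + (A * (η * sy - s * ry)) ^ 2 +
      A * (η * sy - s * ry)| ≤ (A ^ 2 * R * (2 * C ^ 2) + 4 * A ^ 2 * C ^ 2 + A * C + A * B / b) *
        η := by
    rw [hid]
    have h1 : |A ^ 2 * η * (sx ^ 2 + sy ^ 2) * η| ≤ A ^ 2 * R * (2 * C ^ 2) * η := by
      rw [abs_of_nonneg (by positivity)]
      have : sx ^ 2 ≤ C ^ 2 := sq_le_sq' (abs_le.1 hsx).1 (abs_le.1 hsx).2
      have : sy ^ 2 ≤ C ^ 2 := sq_le_sq' (abs_le.1 hsy).1 (abs_le.1 hsy).2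
      gcongr
      linarith
    have h2 : |2 * A ^ 2 * s * (sx * rx + sy * ry) * η| ≤ 4 * A ^ 2 * C ^ 2 * η := by
      have : |sx * rx + sy * ry| ≤ C * C + C * C := by
        refine (abs_add_le _ _).trans ?_
        rw [abs_mul, abs_mul]
        gcongr
      rw [abs_mul, abs_mul, abs_mul, abs_of_nonneg hη, abs_of_pos (by positivity : 0 < 2 * A ^ 2)]
      calc _ ≤ 2 * A ^ 2 * 1 * (C * C + C * C) * η := by gcongr
        _ = _ := by ring
    have h3 : |A * sy * η| ≤ A * C * η := by
      rw [abs_mul, abs_mul, abs_of_nonneg hη, abs_of_pos hA]; gcongr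
    have h4 : |A * s ^ 2 * ((A - m) / D)| ≤ A * B / b * η := by
      rw [abs_of_nonneg (by positivity)]
      calc _ ≤ A * 1 * (B * η / b) := by gcongr
        _ = _ := by ring
    calc _ ≤ |A ^ 2 * η * (sx ^ 2 + sy ^ 2) * η| + |2 * A ^ 2 * s * (sx * rx + sy * ry) * η| +
          |A * sy * η| + |A * s ^ 2 * ((A - m) / D)| := by
          refine (abs_add_le _ _).trans (add_le_add_left ?_ _)
          refine (abs_add_le _ _).trans (add_le_add_left ?_ _)
          exact abs_sub _ _
      _ ≤ _ := by linarith
  calc _ ≤ B * |s| * ((A ^ 2 * R * (2 * C ^ 2) + 4 * A ^ 2 * C ^ 2 + A * C + A * B / b) * η) := by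
        gcongr
    _ = _ := by field_simp

lemma layerAmp_eventuallyEq_zero (ha : 0 < a) (hR : 0 < R) {f : ℝ × ℝ → ℝ} {δ : ℝ → ℝ}
    (hδ0 : ∀ η ∈ Icc (3 * R / 4) R, δ η = 0) {p : ℝ × ℝ}
    (h : ellM a p < (a * sinh (R / 4)) ^ 2) : layerAmp a R f δ =ᶠ[𝓝 p] 0 := by
  filter_upwards [(isOpen_lt (continuous_ellM a) continuous_const).mem_nhds h] with q hq
  have h1 := ellRho_lt_of_ellM_lt ha (by positivity : 0 < R / 4) hq
  have h2 := ellRho_nonneg (p := q) ha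
  rw [layerAmp, hδ0 _ ⟨by linarith, by linarith⟩]
  simp

/-- The explicit phase and amplitude are admissible layer data. -/
lemma exists_isLayerData (ha : 0 < a) (hR : 0 < R) {f u0 : ℝ × ℝ → ℝ} (hf : ContDiff ℝ 1 f)
    (h1 : f (a * cosh R, 0) = 0) (h2 : f (-(a * cosh R), 0) = 0)
    (hu0 : ∀ p : ℝ × ℝ, u0 p =
      ∫ s in p.2..(a * sinh R * √(1 - p.1 ^ 2 / (a * cosh R) ^ 2)), f (p.1, s))
    {δ : ℝ → ℝ} (hδ : ContDiff ℝ 1 δ) (hδr : ∀ η, δ η ∈ Icc (0 : ℝ) 1) (hδ1 : δ 0 = 1)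
    (hδ0 : ∀ η ∈ Icc (3 * R / 4) R, δ η = 0) :
    ∃ C, IsLayerData (a * cosh R) (a * sinh R) C u0 (layerAmp a R f δ) (layerPhase a R) := by
  have hA : 0 < a * cosh R := by positivity
  have hB : 0 < a * sinh R := mul_pos ha (sinh_pos_iff.2 hR)
  have hn : 0 < a * sinh (R / 4) := mul_pos ha (sinh_pos_iff.2 (by positivity))
  have hb : 0 < (a * sinh (R / 4)) ^ 2 := by positivity
  obtain ⟨L, hL, hH⟩ := exists_abs_le_of_eq_zero (B := a * sinh R)
    (contDiff_one_scaled_integral hf (-1) 1) (A := a * cosh R) (by simp [h1]) (by simp [h2])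
  obtain ⟨C₁, hC₁, hs⟩ := exists_bound_away_from_focal_segment (a := a) hA hB hb
    fun p hM => contDiffAt_ellSin hM
  obtain ⟨C₂, hC₂, hρ⟩ := exists_bound_away_from_focal_segment (a := a) hA hB hb
    fun p hM => contDiffAt_ellRho hM (n := 1)
  obtain ⟨C₃, hC₃, hψ⟩ := exists_bound_away_from_focal_segment (a := a) hA hB hb
    fun p hM => contDiffAt_layerAmp_factor (R := R) hf hδ hM
  obtain ⟨C₄, hC₄, hS⟩ := exists_bound_away_from_focal_segment (a := a) hA hB hb
    fun p hM => (contDiffAt_layerPhase (R := R) hM).of_le one_le_two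
  have hSd : ∀ v, ∀ p, 0 < ellM a p → ContDiffAt ℝ 1 (fun q => fderiv ℝ (layerPhase a R) q v) p :=
    fun v p hM => (contDiffOn_fderiv_apply (isOpen_ellM_pos a)
      (fun q hq => (contDiffAt_layerPhase hq).contDiffWithinAt) v).contDiffAt
      ((isOpen_ellM_pos a).mem_nhds hM)
  obtain ⟨C₅, hC₅, hSx⟩ := exists_bound_away_from_focal_segment hA hB hb (hSd (1, 0))
  obtain ⟨C₆, hC₆, hSy⟩ := exists_bound_away_from_focal_segment hA hB hb (hSd (0, 1))
  have hfac : ∀ p : ℝ × ℝ, 0 < ellM a p → |a * sinh R * (∫ t in (-1 : ℝ)..1,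
      f (a * cosh R * ellCos a p, a * sinh R * ellSin a p * t)) * δ (R - ellRho a p)| ≤
      a * sinh R * L * (a * cosh R + a * sinh R) * |ellSin a p| := by
    intro p hM
    have hcs := ellCos_sq_add_ellSin_sq hM
    have hs1 := abs_ellSin_le_one hM
    have hc1 : |ellCos a p| ≤ 1 := abs_le_of_sq_le_sq (by nlinarith [sq_nonneg (ellSin a p)])
      zero_le_one
    have := hH (a * cosh R * ellCos a p) (a * sinh R * ellSin a p)
      (by rw [abs_mul, abs_of_pos hA]; nlinarith) (by rw [abs_mul, abs_of_pos hB]; nlinarith)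
    have hc : 1 - |ellCos a p| ≤ |ellSin a p| := by
      nlinarith [sq_abs (ellCos a p), sq_abs (ellSin a p), abs_nonneg (ellCos a p),
        abs_nonneg (ellSin a p)]
    rw [abs_mul, abs_mul, abs_of_pos hB, abs_of_nonneg (hδr _).1]
    refine (mul_le_of_le_one_right (by positivity) (hδr _).2).trans ?_
    rw [mul_assoc (a * sinh R) L, mul_assoc (a * sinh R) (L * _), mul_assoc L]
    refine mul_le_mul_of_nonneg_left (this.trans ?_) hB.le
    refine mul_le_mul_of_nonneg_left ?_ hL
    rw [abs_mul (a * cosh R), abs_mul (a * sinh R), abs_of_pos hA, abs_of_pos hB]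
    nlinarith
  set b := (a * sinh (R / 4)) ^ 2 with hbdef
  set n := a * sinh (R / 4)
  set L' := a * sinh R * L * (a * cosh R + a * sinh R)
  have hL' : 0 ≤ L' := by positivity
  have hsn : ∀ p : ℝ × ℝ, b ≤ ellM a p → |ellSin a p| ≤ |p.2| / n := by
    intro p hM
    rw [ellSin, abs_div, abs_of_nonneg (sqrt_nonneg _)]
    gcongr
    exact le_sqrt_of_sq_le hM
  set C₇ := a * sinh R / (a * cosh R) * ((a * cosh R) ^ 2 * R * (2 * (C₁ + C₂) ^ 2) +
        4 * (a * cosh R) ^ 2 * (C₁ + C₂) ^ 2 + a * cosh R * (C₁ + C₂) +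
        a * cosh R * (a * sinh R) / b)
  have hC₇ : 0 ≤ C₇ := by positivity
  have hK₁ : 0 ≤ L' / b := by positivity
  have hK₂ : 0 ≤ (C₃ + L' * C₁) / n := by positivity
  refine ⟨L' / b + (C₃ + L' * C₁) / n + C₄ + C₅ + C₆ + C₇, by positivity, ?_, ?_, ?_, ?_, ?_,
    ?_, ?_⟩
  · exact fun p _ hy => contDiffAt_layerAmp hf hδ (ellM_pos ha hy.ne)
  · exact fun p _ hy => contDiffAt_layerPhase (ellM_pos ha hy.ne)
  · intro p hp hy
    rcases lt_or_ge (ellM a p) b with hM | hM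
    · rw [(layerAmp_eventuallyEq_zero ha hR hδ0 hM).eq_of_nhds]
      simp only [Pi.zero_apply, abs_zero]
      positivity
    · have hM0 := hb.trans_le hM
      have := hsn p hM
      calc |layerAmp a R f δ p| ≤ |ellSin a p| * (L' * |ellSin a p|) := by
            rw [layerAmp, abs_mul]
            exact mul_le_mul_of_nonneg_left (hfac p hM0) (abs_nonneg _)
        _ ≤ |p.2| / n * (L' * (|p.2| / n)) := by gcongr
        _ = L' / b * p.2 ^ 2 := by rw [hbdef, ← sq_abs p.2]; field_simp
        _ ≤ _ := by gcongr; linarith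
  · intro p hp hy
    rcases lt_or_ge (ellM a p) b with hM | hM
    · rw [(layerAmp_eventuallyEq_zero ha hR hδ0 hM).fderiv_eq]
      simp only [fderiv_zero, Pi.zero_apply, norm_zero]
      positivity
    · have hM0 := hb.trans_le hM
      have hfd := (((contDiffAt_ellSin hM0 (n := 1)).differentiableAt one_ne_zero).hasFDerivAt).mul
        ((contDiffAt_layerAmp_factor (R := R) hf hδ hM0).differentiableAt one_ne_zero).hasFDerivAt
      have hfd' : HasFDerivAt (layerAmp a R f δ) _ p := hfd
      rw [hfd'.fderiv]
      refine (norm_add_le _ _).trans ?_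
      rw [norm_smul, norm_smul, norm_eq_abs, norm_eq_abs]
      calc _ ≤ |p.2| / n * C₃ + L' * (|p.2| / n) * C₁ := by
            gcongr
            · exact hsn p hM
            · exact hψ p hp hM
            · refine (hfac p hM0).trans ?_
              gcongr
              exact hsn p hM
            · exact hs p hp hM
        _ = (C₃ + L' * C₁) / n * |p.2| := by ring
        _ ≤ _ := by gcongr; linarith
  · exact fun p hp hy => ellPhase_le ha hR hp hy
  · intro p hp hy
    refine (lt_or_ge (ellM a p) b).imp (layerAmp_eventuallyEq_zero ha hR hδ0) fun hM => ?_
    refine ⟨(hS p hp hM).trans (by linarith), (hSx p hp hM).trans (by linarith),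
      (hSy p hp hM).trans (by linarith), ?_⟩
    refine (layerPhase_eikonal ha hR hb hp hM ((hs p hp hM).trans (le_add_of_nonneg_right hC₂))
      ((hρ p hp hM).trans (le_add_of_nonneg_left hC₁))).trans ?_
    gcongr
    linarith
  · intro p hp hy
    have hM0 := ellM_pos ha hy.ne
    have hM := ellM_eq_of_mem ha hR hM0 hp
    have hρR := ellRho_eq_of_mem ha hR hM
    have hx' := fst_eq_ellCos hM0
    have hy' := snd_eq_ellSin hM0
    rw [← cosh_ellRho ha, hρR] at hx'
    rw [hM, sqrt_sq hB.le] at hy'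
    refine ⟨by rw [layerPhase, hρR, sub_self, mul_zero], ?_⟩
    have hpe : p = (a * cosh R * ellCos a p, a * sinh R * ellSin a p) :=
      Prod.ext (hx'.trans (mul_comm _ _)) (hy'.trans (mul_comm _ _))
    have := limitSolution_lower hA hu0 (ellCos_sq_add_ellSin_sq hM0) (ellSin_neg ha hy).le
    rw [← hpe] at this
    rw [layerAmp, hρR, sub_self, hδ1, this]
    ring

end LayerData

lemma integral_le_of_lintegral_le {α : Type*} [MeasurableSpace α] {μ : Measure α} {g E : α → ℝ}
    {r c : ℝ} (hr : 0 ≤ r) (hc : 0 ≤ c) (hg : ∀ᵐ x ∂μ, g x ≤ r * E x)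
    (hE : ∫⁻ x, ENNReal.ofReal (E x) ∂μ ≤ ENNReal.ofReal c) : ∫ x, g x ∂μ ≤ r * c := by
  have hl : ∫⁻ x, ENNReal.ofReal (g x) ∂μ ≤ ENNReal.ofReal (r * c) := by
    calc _ ≤ ∫⁻ x, ENNReal.ofReal r * ENNReal.ofReal (E x) ∂μ := by
          refine lintegral_mono_ae (hg.mono fun x hx => ?_)
          rw [← ENNReal.ofReal_mul hr]
          exact ENNReal.ofReal_le_ofReal hx
      _ = ENNReal.ofReal r * ∫⁻ x, ENNReal.ofReal (E x) ∂μ :=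
          lintegral_const_mul' _ _ ENNReal.ofReal_ne_top
      _ ≤ _ := by rw [ENNReal.ofReal_mul hr]; gcongr
  by_cases hi : Integrable g μ
  · rw [integral_eq_lintegral_pos_part_sub_lintegral_neg_part hi]
    refine (sub_le_self _ ENNReal.toReal_nonneg).trans ?_
    exact ENNReal.toReal_le_of_le_ofReal (by positivity) hl
  · rw [integral_undef hi]; positivity

/-- The corrector, given in elliptic coordinates, is the layer function off the focal axis. -/
lemma corrector_eq_lowerExt {a R : ℝ} (ha : 0 < a) (hR : 0 < R) {f u0 φ : ℝ × ℝ → ℝ}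
    (hu0 : ∀ p : ℝ × ℝ, u0 p =
      ∫ s in p.2..(a * sinh R * √(1 - p.1 ^ 2 / (a * cosh R) ^ 2)), f (p.1, s))
    {δ : ℝ → ℝ} {ε : ℝ}
    (hφ : ∀ η ∈ Ico (0 : ℝ) R, ∀ τ ∈ Icc (0 : ℝ) (2 * π),
      φ (a * cosh (R - η) * cos τ, a * sinh (R - η) * sin τ)
        = -u0 (a * cosh R * cos τ, a * sinh R * sin τ) * exp (a * cosh R * sin τ * η / ε) *
            (if τ ∈ Icc π (2 * π) then (1 : ℝ) else 0) * δ η)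
    {p : ℝ × ℝ} (hp : p.1 ^ 2 / (a * cosh R) ^ 2 + p.2 ^ 2 / (a * sinh R) ^ 2 < 1)
    (hy : p.2 ≠ 0) :
    φ p = lowerExt (fun q => layerAmp a R f δ q * exp (layerPhase a R q / ε)) p := by
  have hM := ellM_pos ha hy
  have hρ := ellRho_pos ha hM
  have hρR := ellRho_lt_of_ellM_lt ha hR (ellM_lt_of_mem ha hR hM hp)
  have hcs := ellCos_sq_add_ellSin_sq hM
  have hA : 0 < a * cosh R := by positivity
  have hη : R - ellRho a p ∈ Ico (0 : ℝ) R := ⟨by linarith, by linarith⟩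
  have hc : -1 ≤ ellCos a p ∧ ellCos a p ≤ 1 := abs_le_of_sq_le_sq' (by nlinarith) zero_le_one
  have hcos : cos (arccos (ellCos a p)) = ellCos a p := cos_arccos hc.1 hc.2
  have hsin : sin (arccos (ellCos a p)) = |ellSin a p| := by
    rw [sin_arccos, show 1 - ellCos a p ^ 2 = ellSin a p ^ 2 by linarith, sqrt_sq_eq_abs]
  have hpe : (a * cosh (R - (R - ellRho a p)) * ellCos a p,
      a * sinh (R - (R - ellRho a p)) * ellSin a p) = p := by
    rw [sub_sub_cancel, cosh_ellRho ha, sinh_ellRho ha, mul_comm, ← fst_eq_ellCos hM, mul_comm,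
      ← snd_eq_ellSin hM]
  have h0 := arccos_nonneg (ellCos a p)
  have hπ := arccos_le_pi (ellCos a p)
  rcases hy.lt_or_gt with hy | hy
  · have hs := ellSin_neg ha hy
    have := hφ _ hη (2 * π - arccos (ellCos a p)) ⟨by linarith [pi_pos], by linarith⟩
    rw [cos_two_pi_sub, sin_two_pi_sub, hcos, hsin, abs_of_neg hs, neg_neg, hpe,
      if_pos ⟨by linarith, by linarith⟩, limitSolution_lower hA hu0 hcs hs.le] at this
    rw [this, lowerExt_of_neg hy, layerAmp, layerPhase]
    ring
  · have hs : 0 < ellSin a p := div_pos hy (sqrt_pos.2 hM)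
    have hlt : arccos (ellCos a p) ≠ π := fun h => by
      rw [h, sin_pi, abs_of_pos hs] at hsin
      linarith
    have := hφ _ hη (arccos (ellCos a p)) ⟨h0, by linarith [pi_pos]⟩
    rw [hcos, hsin, abs_of_pos hs, hpe, if_neg fun h => hlt (le_antisymm hπ h.1)] at this
    rw [this, lowerExt_of_nonneg hy.le]
    ring

lemma ae_snd_ne_zero : ∀ᵐ p : ℝ × ℝ, p.2 ≠ 0 := by
  rw [Measure.volume_eq_prod]
  exact Measure.quasiMeasurePreserving_snd.ae (Measure.ae_ne volume 0)

/-- An energy bound for `w` controls the norms of any function which agrees with it off the axis. -/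
lemma norms_le_of_lintegral_le {Ω : Set (ℝ × ℝ)} (hΩ : IsOpen Ω) {w v : ℝ × ℝ → ℝ} {K ε : ℝ}
    (hK : 0 ≤ K) (hε : 0 < ε) (hε1 : ε ≤ 1) (hw : ContDiffOn ℝ 1 w Ω)
    (hv : ∀ p ∈ Ω, p.2 ≠ 0 → v p = w p)
    (hE : ∫⁻ p in Ω, ENNReal.ofReal (ε / 2 * (fderiv ℝ w p (1, 0) ^ 2 + fderiv ℝ w p (0, 1) ^ 2) +
      w p ^ 2 / 16) ≤ ENNReal.ofReal (K * ε)) :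
    L2norm v Ω + √ε * H1norm v Ω ≤ (8 * √K + 1) * √ε := by
  have hae : ∀ᵐ p ∂(volume.restrict Ω), v p = w p ∧ partialX v p = fderiv ℝ w p (1, 0) ∧
      partialY v p = fderiv ℝ w p (0, 1) := by
    rw [ae_restrict_iff' hΩ.measurableSet]
    filter_upwards [ae_snd_ne_zero] with p hy hp
    have he : v =ᶠ[𝓝 p] w := by
      filter_upwards [hΩ.mem_nhds hp, (isOpen_ne.preimage continuous_snd).mem_nhds hy] with q hq hqy
      exact hv q hq hqy
    have hd := (hw.contDiffAt (hΩ.mem_nhds hp)).differentiableAt one_ne_zero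
    exact ⟨hv p hp hy, (partialX_congr he).trans (partialX_eq_fderiv hd),
      (partialY_congr he).trans (partialY_eq_fderiv hd)⟩
  have h2 : ∫ p in Ω, v p ^ 2 ≤ 16 * (K * ε) := by
    refine integral_le_of_lintegral_le (by norm_num) (by positivity) (hae.mono fun p hp => ?_) hE
    rw [hp.1]
    have : 0 ≤ ε / 2 * (fderiv ℝ w p (1, 0) ^ 2 + fderiv ℝ w p (0, 1) ^ 2) := by positivity
    linarith
  have h1 : ∫ p in Ω, v p ^ 2 + partialX v p ^ 2 + partialY v p ^ 2 ≤ 16 / ε * (K * ε) := by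
    refine integral_le_of_lintegral_le (by positivity) (by positivity)
      (hae.mono fun p hp => ?_) hE
    rw [hp.1, hp.2.1, hp.2.2]
    have h3 : 16 / ε * (ε / 2 * (fderiv ℝ w p (1, 0) ^ 2 + fderiv ℝ w p (0, 1) ^ 2) +
        w p ^ 2 / 16) =
        8 * (fderiv ℝ w p (1, 0) ^ 2 + fderiv ℝ w p (0, 1) ^ 2) + w p ^ 2 / ε := by
      field_simp; ring
    have h4 : w p ^ 2 ≤ w p ^ 2 / ε := le_div_self (sq_nonneg _) hε hε1
    nlinarith [sq_nonneg (fderiv ℝ w p (1, 0)), sq_nonneg (fderiv ℝ w p (0, 1))]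
  have e2 : L2norm v Ω ≤ 4 * √K * √ε := by
    rw [L2norm, ← sqrt_eq_rpow]
    refine (sqrt_le_sqrt h2).trans_eq ?_
    rw [sqrt_mul (by norm_num), sqrt_mul hK, show (16 : ℝ) = 4 ^ 2 by norm_num,
      sqrt_sq (by norm_num)]
    ring
  have e1 : H1norm v Ω ≤ 4 * √K := by
    rw [H1norm, ← sqrt_eq_rpow]
    refine (sqrt_le_sqrt h1).trans_eq ?_
    rw [show 16 / ε * (K * ε) = 4 ^ 2 * K by field_simp; ring, sqrt_mul (by norm_num),
      sqrt_sq (by norm_num)]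
  have := mul_le_mul_of_nonneg_left e1 (sqrt_nonneg ε)
  linarith [sqrt_nonneg ε]

/-- convergence theorem on the ellipse
`Ω = {x²/A² + y²/B² < 1}`, `A = a·cosh R`, `B = a·sinh R`. Under the
compatibility conditions on `f` at the characteristic points `(±A,0)`, with
`u⁰(x,y) = ∫_y^{C_u(x)} f(x,s) ds`, `C_u(x) = B√(1 - x²/A²)`, and the
approximate corrector `φ̄⁰` defined in elliptic boundary-fitted coordinates
`x = a·cosh(R-η)cos τ`, `y = a·sinh(R-η)sin τ` by
`φ̄⁰ = -u⁰(A cos τ, B sin τ)·exp(A·sin(τ)·η/ε)·χ_{[π,2π]}(τ)·δ(η)`, every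
classical solution `u^ε` of `-εΔu^ε - ∂_y u^ε = f`, `u^ε|∂Ω = 0` satisfies
`‖u^ε - u⁰ - φ̄⁰‖_{L²(Ω)} + √ε‖u^ε - u⁰ - φ̄⁰‖_{H¹(Ω)} ≤ κ√ε`
with `κ` independent of `ε ∈ (0,1]`. -/
theorem stmt13 (a R : ℝ) (ha : 0 < a) (hR : 0 < R)
    (f : ℝ × ℝ → ℝ) (hf : ContDiff ℝ (⊤ : ℕ∞) f)
    (hcompat : ∀ p₁ p₂ : ℕ, 2 * p₁ + p₂ ≤ 2 →
      deriv^[p₁] (fun x => deriv^[p₂] (fun y => f (x, y)) 0) (a * Real.cosh R) = 0 ∧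
      deriv^[p₁] (fun x => deriv^[p₂] (fun y => f (x, y)) 0) (-(a * Real.cosh R)) = 0)
    (u0 : ℝ × ℝ → ℝ)
    (hu0 : ∀ p : ℝ × ℝ, u0 p =
      ∫ s in p.2..(a * Real.sinh R *
          Real.sqrt (1 - p.1 ^ 2 / (a * Real.cosh R) ^ 2)), f (p.1, s))
    (δ : ℝ → ℝ) (hδsmooth : ContDiff ℝ (⊤ : ℕ∞) δ)
    (hδrange : ∀ η : ℝ, δ η ∈ Icc (0 : ℝ) 1)
    (hδ1 : ∀ η ∈ Icc (0 : ℝ) (R / 2), δ η = 1)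
    (hδ0 : ∀ η ∈ Icc (3 * R / 4) R, δ η = 0) :
    ∃ κ > (0 : ℝ), ∀ ε ∈ Ioc (0 : ℝ) 1, ∀ φ : ℝ × ℝ → ℝ,
      (∀ η ∈ Ico (0 : ℝ) R, ∀ τ ∈ Icc (0 : ℝ) (2 * π),
        φ (a * Real.cosh (R - η) * Real.cos τ, a * Real.sinh (R - η) * Real.sin τ)
          = -u0 (a * Real.cosh R * Real.cos τ, a * Real.sinh R * Real.sin τ) *
              Real.exp (a * Real.cosh R * Real.sin τ * η / ε) *
              (if τ ∈ Icc π (2 * π) then (1 : ℝ) else 0) * δ η) →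
      ∀ u : ℝ × ℝ → ℝ,
        ContDiffOn ℝ 2 u
          {p : ℝ × ℝ |
            p.1 ^ 2 / (a * Real.cosh R) ^ 2 + p.2 ^ 2 / (a * Real.sinh R) ^ 2 < 1} →
        ContinuousOn u
          {p : ℝ × ℝ |
            p.1 ^ 2 / (a * Real.cosh R) ^ 2 + p.2 ^ 2 / (a * Real.sinh R) ^ 2 ≤ 1} →
        (∀ p : ℝ × ℝ,
          p.1 ^ 2 / (a * Real.cosh R) ^ 2 + p.2 ^ 2 / (a * Real.sinh R) ^ 2 < 1 →
          -ε * (partialX (partialX u) p + partialY (partialY u) p) - partialY u p = f p) →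
        (∀ p : ℝ × ℝ,
          p.1 ^ 2 / (a * Real.cosh R) ^ 2 + p.2 ^ 2 / (a * Real.sinh R) ^ 2 = 1 →
          u p = 0) →
        L2norm (fun p => u p - u0 p - φ p)
            {p : ℝ × ℝ |
              p.1 ^ 2 / (a * Real.cosh R) ^ 2 + p.2 ^ 2 / (a * Real.sinh R) ^ 2 < 1}
          + Real.sqrt ε *
            H1norm (fun p => u p - u0 p - φ p)
              {p : ℝ × ℝ |
                p.1 ^ 2 / (a * Real.cosh R) ^ 2 + p.2 ^ 2 / (a * Real.sinh R) ^ 2 < 1}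
          ≤ κ * Real.sqrt ε := by
  have hA : 0 < a * Real.cosh R := by positivity
  have hB : 0 < a * Real.sinh R := mul_pos ha (sinh_pos_iff.2 hR)
  have hf1 : ContDiff ℝ 1 f := hf.of_le (by exact_mod_cast le_top)
  have hδ : ContDiff ℝ 1 δ := hδsmooth.of_le (by exact_mod_cast le_top)
  obtain ⟨h1, h2⟩ := hcompat 0 0 (by norm_num)
  obtain ⟨C₀, hC₀⟩ := fderiv_limitSolution hA hB hf1 h1 h2 hu0
  obtain ⟨C, hC⟩ := exists_isLayerData ha hR hf1 h1 h2 hu0 hδ hδrange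
    (hδ1 0 ⟨le_rfl, by positivity⟩) hδ0
  obtain ⟨K, hK, hest⟩ := exists_lintegral_remainder_le hA hB hC
    (continuous_limitSolution hf1 hu0) (contDiffOn_limitSolution hf1 hu0) hC₀
    fun p hp hy => limitSolution_eq_zero hB hu0 hp hy
  refine ⟨8 * √K + 1, by positivity, fun ε hε φ hφ u hu huc hpde hub => ?_⟩
  obtain ⟨hw, hE⟩ := hest ε hε u hu huc hpde hub _ rfl
  refine norms_le_of_lintegral_le (isOpen_ellipse _ _) hK hε.1 hε.2 hw (fun p hp hy => ?_) hE
  rw [corrector_eq_lowerExt ha hR hu0 hφ hp hy]
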